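/- arXiv:0907.4684 — 3 statements merged into one kernel-verified Lean document; each statement's English description precedes it below -/
import Mathlib

section
/- For an ergodic dynamical system (X, T, μ) with X a compact metric space in ℝ^n, for every grid θ and every q > 0, the chain of inequalities D_τ^±(q) ≤ Δ_τ^±(θ,q) ≤ Δ_μ^±(θ,q) = D_μ^±(q) holds. -/
open MeasureTheory Filter Set
open scoped ENNReal Topology NNReal

noncomputable section

/-- First return time of `x` to the set `A` under the map `T`;
by convention it is `0` if the orbit of `x` never returns to `A`. -/
def firstReturn {α : Type*} (T : α → α) (A : Set α) (x : α) : ℕ :=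
  sInf {k : ℕ | 0 < k ∧ T^[k] x ∈ A}

/-- Extended logarithm `ℝ≥0∞ → EReal`. -/
def elog (x : ℝ≥0∞) : EReal :=
  if x = 0 then ⊥ else if x = ⊤ then ⊤ else ((Real.log x.toReal : ℝ) : EReal)

section Generic

variable {α : Type*} [MeasurableSpace α] [PseudoMetricSpace α]

/-- The measure partition function `Γ_μ(ε,q)`. -/
def measPF (μ : Measure α) (ε q : ℝ) : ℝ≥0∞ :=
  ∫⁻ x, μ (Metric.ball x ε) ^ (q - 1) ∂μ

/-- The logarithmic measure partition function `Γ^l_μ(ε)`. -/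
def measPFlog (μ : Measure α) (ε : ℝ) : ℝ :=
  ∫ x, Real.log (μ (Metric.ball x ε)).toReal ∂μ

/-- The return time partition function `Γ_τ(ε,q)`. -/
def retPF (T : α → α) (μ : Measure α) (ε q : ℝ) : ℝ≥0∞ :=
  ∫⁻ x, (firstReturn T (Metric.ball x ε) x : ℝ≥0∞) ^ (1 - q) ∂μ

/-- The logarithmic return time partition function `Γ^l_τ(ε)`. -/
def retPFlog (T : α → α) (μ : Measure α) (ε : ℝ) : ℝ :=
  ∫ x, Real.log ((firstReturn T (Metric.ball x ε) x : ℝ))⁻¹ ∂μ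

/-- The scaling exponent `(1/(q-1)) · log F(ε) / log ε`. -/
def dimScale (F : ℝ → ℝ≥0∞) (q : ℝ) (ε : ℝ) : EReal :=
  ((((q - 1) * Real.log ε)⁻¹ : ℝ) : EReal) * elog (F ε)

/-- Upper generalized dimension obtained from a one-parameter family of partition
functions `F ε`, with the logarithmic convention at `q = 1`. -/
def dimPlus (F : ℝ → ℝ≥0∞) (Flog : ℝ → ℝ) (q : ℝ) : EReal :=
  if q = 1 then ((limsup (fun ε => Flog ε / Real.log ε) (𝓝[>] (0:ℝ)) : ℝ) : EReal)
  else limsup (dimScale F q) (𝓝[>] (0:ℝ))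

/-- Lower generalized dimension. -/
def dimMinus (F : ℝ → ℝ≥0∞) (Flog : ℝ → ℝ) (q : ℝ) : EReal :=
  if q = 1 then ((liminf (fun ε => Flog ε / Real.log ε) (𝓝[>] (0:ℝ)) : ℝ) : EReal)
  else liminf (dimScale F q) (𝓝[>] (0:ℝ))

/-- Generalized measure dimensions `D_μ^+(q)`. -/
def DmuPlus (μ : Measure α) (q : ℝ) : EReal :=
  dimPlus (fun ε => measPF μ ε q) (measPFlog μ) q

/-- Generalized measure dimensions `D_μ^-(q)`. -/
def DmuMinus (μ : Measure α) (q : ℝ) : EReal :=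
  dimMinus (fun ε => measPF μ ε q) (measPFlog μ) q

/-- Return time generalized dimensions `D_τ^+(q)`. -/
def DtauPlus (T : α → α) (μ : Measure α) (q : ℝ) : EReal :=
  dimPlus (fun ε => retPF T μ ε q) (retPFlog T μ) q

/-- Return time generalized dimensions `D_τ^-(q)`. -/
def DtauMinus (T : α → α) (μ : Measure α) (q : ℝ) : EReal :=
  dimMinus (fun ε => retPF T μ ε q) (retPFlog T μ) q

end Generic

/-- Euclidean space `ℝ^n`. -/
abbrev Euc (n : ℕ) := EuclideanSpace ℝ (Fin n)

/-- A grid in `ℝ^n` : a choice of origin and orientation, determining for every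
side length `ε` a partition of `ℝ^n` into half-open cubes of side `ε`. -/
structure Grid (n : ℕ) where
  origin : Euc n
  rot : Euc n ≃ₗᵢ[ℝ] Euc n

/-- Coordinates of a point w.r.t. a grid. -/
def Grid.coords {n : ℕ} (θ : Grid n) (x : Euc n) : Fin n → ℝ :=
  fun i => θ.rot.symm (x - θ.origin) i

/-- The cube `A_j` of side `ε` of the grid `θ`, indexed by `j : Fin n → ℤ`. -/
def Grid.box {n : ℕ} (θ : Grid n) (ε : ℝ) (j : Fin n → ℤ) : Set (Euc n) :=
  {x | ∀ i, (j i : ℝ) * ε ≤ θ.coords x i ∧ θ.coords x i < ((j i : ℝ) + 1) * ε}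

/-- The enlarged cube `Ā_j` of side `3ε` concentric with `A_j`. -/
def Grid.bigBox {n : ℕ} (θ : Grid n) (ε : ℝ) (j : Fin n → ℤ) : Set (Euc n) :=
  {x | ∀ i, ((j i : ℝ) - 1) * ε ≤ θ.coords x i ∧ θ.coords x i < ((j i : ℝ) + 2) * ε}

/-- Box measure partition function `Υ_μ(θ,ε,q) = Σ_{μ(A_j)>0} μ(A_j)^q`. -/
def boxMeasPF {n : ℕ} (μ : Measure (Euc n)) (θ : Grid n) (ε q : ℝ) : ℝ≥0∞ :=
  ∑' j : Fin n → ℤ, if μ (θ.box ε j) = 0 then 0 else μ (θ.box ε j) ^ q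

/-- Logarithmic box measure partition function `Υ^l_μ(θ,ε)`. -/
def boxMeasPFlog {n : ℕ} (μ : Measure (Euc n)) (θ : Grid n) (ε : ℝ) : ℝ :=
  ∑' j : Fin n → ℤ, (μ (θ.box ε j)).toReal * Real.log (μ (θ.box ε j)).toReal

/-- Return time box partition function `Υ_τ(θ,ε,q)`. -/
def boxRetPF {n : ℕ} (T : Euc n → Euc n) (μ : Measure (Euc n)) (θ : Grid n)
    (ε q : ℝ) : ℝ≥0∞ :=
  ∑' j : Fin n → ℤ, ∫⁻ x in θ.box ε j,
    (firstReturn T (θ.box ε j) x : ℝ≥0∞) ^ (1 - q) ∂μ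

/-- Logarithmic return time box partition function `Υ^l_τ(θ,ε)`. -/
def boxRetPFlog {n : ℕ} (T : Euc n → Euc n) (μ : Measure (Euc n)) (θ : Grid n)
    (ε : ℝ) : ℝ :=
  ∑' j : Fin n → ℤ, ∫ x in θ.box ε j,
    Real.log ((firstReturn T (θ.box ε j) x : ℝ))⁻¹ ∂μ

/-- Riedi's enhanced box partition function `Φ_μ(θ,ε,q)`. -/
def riediPF {n : ℕ} (μ : Measure (Euc n)) (θ : Grid n) (ε q : ℝ) : ℝ≥0∞ :=
  ∑' j : Fin n → ℤ, if μ (θ.box ε j) = 0 then 0 else μ (θ.bigBox ε j) ^ q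

/-- The enhanced box partition function `Ψ_μ(θ,ε,q) = Σ_{μ(A_j)>0} μ(A_j) μ(Ā_j)^{q-1}`. -/
def psiMeasPF {n : ℕ} (μ : Measure (Euc n)) (θ : Grid n) (ε q : ℝ) : ℝ≥0∞ :=
  ∑' j : Fin n → ℤ,
    if μ (θ.box ε j) = 0 then 0 else μ (θ.box ε j) * μ (θ.bigBox ε j) ^ (q - 1)

/-- The logarithmic enhanced box partition function `Ψ^l_μ(θ,ε)`. -/
def psiMeasPFlog {n : ℕ} (μ : Measure (Euc n)) (θ : Grid n) (ε : ℝ) : ℝ :=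
  ∑' j : Fin n → ℤ, (μ (θ.box ε j)).toReal * Real.log (μ (θ.bigBox ε j)).toReal

/-- The enhanced return time box partition function `Ψ_τ(θ,ε,q)`:
the integral is over `A_j` but the return is to the enlarged box `Ā_j`. -/
def psiRetPF {n : ℕ} (T : Euc n → Euc n) (μ : Measure (Euc n)) (θ : Grid n)
    (ε q : ℝ) : ℝ≥0∞ :=
  ∑' j : Fin n → ℤ, ∫⁻ x in θ.box ε j,
    (firstReturn T (θ.bigBox ε j) x : ℝ≥0∞) ^ (1 - q) ∂μ

/-- Box measure dimensions `Δ_μ^+(θ,q)`. -/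
def DeltaMuPlus {n : ℕ} (μ : Measure (Euc n)) (θ : Grid n) (q : ℝ) : EReal :=
  dimPlus (fun ε => boxMeasPF μ θ ε q) (boxMeasPFlog μ θ) q

/-- Box measure dimensions `Δ_μ^-(θ,q)`. -/
def DeltaMuMinus {n : ℕ} (μ : Measure (Euc n)) (θ : Grid n) (q : ℝ) : EReal :=
  dimMinus (fun ε => boxMeasPF μ θ ε q) (boxMeasPFlog μ θ) q

/-- Box return time dimensions `Δ_τ^+(θ,q)`. -/
def DeltaTauPlus {n : ℕ} (T : Euc n → Euc n) (μ : Measure (Euc n)) (θ : Grid n)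
    (q : ℝ) : EReal :=
  dimPlus (fun ε => boxRetPF T μ θ ε q) (boxRetPFlog T μ θ) q

/-- Box return time dimensions `Δ_τ^-(θ,q)`. -/
def DeltaTauMinus {n : ℕ} (T : Euc n → Euc n) (μ : Measure (Euc n)) (θ : Grid n)
    (q : ℝ) : EReal :=
  dimMinus (fun ε => boxRetPF T μ θ ε q) (boxRetPFlog T μ θ) q

end

section RenyiMean

variable {α : Type*} [MeasurableSpace α] {μ : Measure α}

/-- Logarithm of the power mean of order `q - 1` of `f`; at `q = 1` it is the geometric mean. -/
noncomputable def logPowerMean (μ : Measure α) (q : ℝ) (f : α → ℝ≥0∞) : ℝ :=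
  if q = 1 then ∫ x, Real.log (f x).toReal ∂μ
  else (q - 1)⁻¹ * Real.log (∫⁻ x, f x ^ (q - 1) ∂μ).toReal

/-- A weight: a function with values in `[0, 1]` whose inverse is integrable. -/
structure IsWeight (μ : Measure α) (f : α → ℝ≥0∞) : Prop where
  aemeasurable : AEMeasurable f μ
  le_one : ∀ᵐ x ∂μ, f x ≤ 1
  lintegral_inv_ne_top : ∫⁻ x, (f x)⁻¹ ∂μ ≠ ⊤

namespace IsWeight

variable {f g : α → ℝ≥0∞} {q : ℝ}

theorem ae_ne_zero (hf : IsWeight μ f) : ∀ᵐ x ∂μ, f x ≠ 0 := by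
  filter_upwards [ae_lt_top' hf.aemeasurable.inv hf.lintegral_inv_ne_top] with x hx h0
  simp [h0] at hx

theorem ae_ne_top (hf : IsWeight μ f) : ∀ᵐ x ∂μ, f x ≠ ⊤ := by
  filter_upwards [hf.le_one] with x hx
  exact ne_top_of_le_ne_top ENNReal.one_ne_top hx

theorem of_le (hf : IsWeight μ f) (hg : AEMeasurable g μ) (hg1 : ∀ᵐ x ∂μ, g x ≤ 1)
    (hfg : ∀ᵐ x ∂μ, f x ≤ g x) : IsWeight μ g := by
  refine ⟨hg, hg1, ne_top_of_le_ne_top hf.lintegral_inv_ne_top (lintegral_mono_ae ?_)⟩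
  filter_upwards [hfg] with x hx
  exact ENNReal.inv_le_inv.2 hx

theorem lintegral_rpow_ne_top [IsProbabilityMeasure μ] (hf : IsWeight μ f) (hq : 0 < q) :
    ∫⁻ x, f x ^ (q - 1) ∂μ ≠ ⊤ := by
  have h : ∫⁻ x, f x ^ (q - 1) ∂μ ≤ ∫⁻ x, (f x)⁻¹ ∂μ := by
    refine lintegral_mono_ae ?_
    filter_upwards [hf.le_one] with x hx
    rw [← ENNReal.rpow_neg_one]
    exact ENNReal.rpow_le_rpow_of_exponent_ge hx (by linarith)
  exact ne_top_of_le_ne_top hf.lintegral_inv_ne_top h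

theorem lintegral_rpow_ne_zero [IsProbabilityMeasure μ] (hf : IsWeight μ f) :
    ∫⁻ x, f x ^ (q - 1) ∂μ ≠ 0 := by
  rw [Ne, lintegral_eq_zero_iff' (hf.aemeasurable.pow_const _)]
  intro h
  have : ∀ᵐ x ∂μ, False := by
    filter_upwards [h, hf.ae_ne_zero, hf.ae_ne_top] with x hx h0 ht
    exact (ENNReal.rpow_pos (pos_iff_ne_zero.2 h0) ht).ne' hx
  exact this.exists.elim fun _ h => h

theorem lintegral_rpow_mul_inv_ne_zero [IsProbabilityMeasure μ] (hf : IsWeight μ f)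
    (hg : IsWeight μ g) : ∫⁻ x, g x ^ q * (f x)⁻¹ ∂μ ≠ 0 := by
  have hm : AEMeasurable (fun x => g x ^ q * (f x)⁻¹) μ :=
    (hg.aemeasurable.pow_const _).mul hf.aemeasurable.inv
  rw [Ne, lintegral_eq_zero_iff' hm]
  intro h
  have : ∀ᵐ x ∂μ, False := by
    filter_upwards [h, hg.ae_ne_zero, hg.ae_ne_top, hf.ae_ne_top] with x hx h0 ht hft
    refine (ENNReal.mul_pos (ENNReal.rpow_pos (pos_iff_ne_zero.2 h0) ht).ne' ?_).ne' hx
    simpa using hft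
  exact this.exists.elim fun _ h => h

theorem integrable_log (hf : IsWeight μ f) : Integrable (fun x => Real.log (f x).toReal) μ := by
  have hi : Integrable (fun x => ((f x)⁻¹).toReal) μ :=
    integrable_toReal_of_lintegral_ne_top hf.aemeasurable.inv hf.lintegral_inv_ne_top
  refine hi.mono' (hf.aemeasurable.ennreal_toReal.log).aestronglyMeasurable ?_
  filter_upwards [hf.le_one, hf.ae_ne_zero, hf.ae_ne_top] with x h1 h0 ht
  have hpos : 0 < (f x).toReal := ENNReal.toReal_pos h0 ht
  have hle : (f x).toReal ≤ 1 := by simpa using ENNReal.toReal_mono ENNReal.one_ne_top h1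
  rw [Real.norm_eq_abs, abs_of_nonpos (Real.log_nonpos hpos.le hle), ← Real.log_inv,
    ENNReal.toReal_inv]
  exact (Real.log_le_sub_one_of_pos (inv_pos.2 hpos)).trans (by linarith)

theorem log_lintegral_rpow [IsProbabilityMeasure μ] :
    Real.log (∫⁻ x, f x ^ (q - 1) ∂μ).toReal = (q - 1) * logPowerMean μ q f := by
  by_cases h : q = 1
  · simp [h]
  · have : q - 1 ≠ 0 := sub_ne_zero.2 h
    rw [logPowerMean, if_neg h]
    field_simp

theorem logPowerMean_mono [IsProbabilityMeasure μ] (hf : IsWeight μ f) (hg : IsWeight μ g)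
    (hq : 0 < q) (hfg : ∀ᵐ x ∂μ, f x ≤ g x) : logPowerMean μ q f ≤ logPowerMean μ q g := by
  have hF := ENNReal.toReal_pos (hf.lintegral_rpow_ne_zero (q := q)) (hf.lintegral_rpow_ne_top hq)
  have hG := ENNReal.toReal_pos (hg.lintegral_rpow_ne_zero (q := q)) (hg.lintegral_rpow_ne_top hq)
  rcases lt_trichotomy q 1 with h | h | h
  · have h1 : Real.log (∫⁻ x, g x ^ (q - 1) ∂μ).toReal
        ≤ Real.log (∫⁻ x, f x ^ (q - 1) ∂μ).toReal := by
      refine Real.log_le_log hG (ENNReal.toReal_mono (hf.lintegral_rpow_ne_top hq)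
        (lintegral_mono_ae ?_))
      filter_upwards [hfg] with x hx
      rw [← neg_sub 1 q, ENNReal.rpow_neg, ENNReal.rpow_neg, ENNReal.inv_le_inv]
      exact ENNReal.rpow_le_rpow hx (by linarith)
    rw [log_lintegral_rpow, log_lintegral_rpow] at h1
    nlinarith
  · simp only [logPowerMean, h, if_true]
    refine integral_mono_ae hf.integrable_log hg.integrable_log ?_
    filter_upwards [hfg, hf.ae_ne_zero, hf.ae_ne_top, hg.ae_ne_top] with x hx h0 ht hgt
    exact Real.log_le_log (ENNReal.toReal_pos h0 ht) (ENNReal.toReal_mono hgt hx)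
  · have h1 : Real.log (∫⁻ x, f x ^ (q - 1) ∂μ).toReal
        ≤ Real.log (∫⁻ x, g x ^ (q - 1) ∂μ).toReal := by
      refine Real.log_le_log hF (ENNReal.toReal_mono (hg.lintegral_rpow_ne_top hq)
        (lintegral_mono_ae ?_))
      filter_upwards [hfg] with x hx
      exact ENNReal.rpow_le_rpow hx (by linarith)
    rw [log_lintegral_rpow, log_lintegral_rpow] at h1
    nlinarith

theorem one [IsProbabilityMeasure μ] : IsWeight μ (fun _ => 1) :=
  ⟨aemeasurable_const, by simp, by simp⟩

theorem logPowerMean_one [IsProbabilityMeasure μ] : logPowerMean μ q (fun _ => 1) = 0 := by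
  simp [logPowerMean]

theorem logPowerMean_nonpos [IsProbabilityMeasure μ] (hf : IsWeight μ f) (hq : 0 < q) :
    logPowerMean μ q f ≤ 0 :=
  (hf.logPowerMean_mono one hq hf.le_one).trans_eq logPowerMean_one

/-- Hölder's inequality for logarithmic power means. -/
theorem mul_logPowerMean_le [IsProbabilityMeasure μ] (hf : IsWeight μ f) (hg : IsWeight μ g)
    (hq : 0 < q) (hH : ∫⁻ x, g x ^ q * (f x)⁻¹ ∂μ ≠ ⊤) :
    q * logPowerMean μ q g
      ≤ Real.log (∫⁻ x, g x ^ q * (f x)⁻¹ ∂μ).toReal + logPowerMean μ q f := by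
  have hmH : AEMeasurable (fun x => g x ^ q * (f x)⁻¹) μ :=
    (hg.aemeasurable.pow_const _).mul hf.aemeasurable.inv
  have hH0 := hf.lintegral_rpow_mul_inv_ne_zero (q := q) hg
  have hF := ENNReal.toReal_pos (hf.lintegral_rpow_ne_zero (q := q)) (hf.lintegral_rpow_ne_top hq)
  have hG := ENNReal.toReal_pos (hg.lintegral_rpow_ne_zero (q := q)) (hg.lintegral_rpow_ne_top hq)
  have hHp := ENNReal.toReal_pos hH0 hH
  rcases lt_trichotomy q 1 with h | h | h
  · have key : ∫⁻ x, f x ^ (q - 1) ∂μ ≤ (∫⁻ x, g x ^ q * (f x)⁻¹ ∂μ) ^ (1 - q)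
        * (∫⁻ x, g x ^ (q - 1) ∂μ) ^ q := by
      refine le_trans (le_of_eq (lintegral_congr_ae ?_)) (ENNReal.lintegral_mul_norm_pow_le hmH
        (hg.aemeasurable.pow_const (q - 1)) (p := 1 - q) (q := q) (by linarith) hq.le (by ring))
      filter_upwards [hg.ae_ne_zero, hg.ae_ne_top, hf.ae_ne_zero, hf.ae_ne_top]
        with x hg0 hgt hf0 hft
      rw [ENNReal.mul_rpow_of_nonneg _ _ (by linarith : (0:ℝ) ≤ 1 - q), ENNReal.inv_rpow,
        ← ENNReal.rpow_neg, ← ENNReal.rpow_mul, ← ENNReal.rpow_mul, mul_right_comm,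
        ← ENNReal.rpow_add _ _ hg0 hgt]
      rw [show q * (1 - q) + (q - 1) * q = 0 by ring, ENNReal.rpow_zero, one_mul]
      congr 1
      ring
    have h2 := ENNReal.toReal_mono (ENNReal.mul_ne_top
      (ENNReal.rpow_ne_top_of_nonneg (by linarith) hH)
      (ENNReal.rpow_ne_top_of_nonneg hq.le (hg.lintegral_rpow_ne_top hq))) key
    rw [ENNReal.toReal_mul, ← ENNReal.toReal_rpow, ← ENNReal.toReal_rpow] at h2
    have h3 := Real.log_le_log hF h2
    rw [Real.log_mul (Real.rpow_pos_of_pos hHp _).ne' (Real.rpow_pos_of_pos hG _).ne',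
      Real.log_rpow hHp, Real.log_rpow hG, log_lintegral_rpow, log_lintegral_rpow] at h3
    nlinarith
  · subst h
    set h := (∫⁻ x, g x ^ (1 : ℝ) * (f x)⁻¹ ∂μ).toReal with hh
    have hi : Integrable (fun x => (g x ^ (1 : ℝ) * (f x)⁻¹).toReal) μ :=
      integrable_toReal_of_lintegral_ne_top hmH hH
    have hint : ∫ x, (g x ^ (1 : ℝ) * (f x)⁻¹).toReal ∂μ = h :=
      integral_toReal hmH (ae_lt_top' hmH hH)
    have hle : ∫ x, (Real.log (g x).toReal - Real.log (f x).toReal) ∂μ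
        ≤ ∫ x, (h⁻¹ * (g x ^ (1 : ℝ) * (f x)⁻¹).toReal + (Real.log h - 1)) ∂μ := by
      refine integral_mono_ae (hg.integrable_log.sub hf.integrable_log)
        ((hi.const_mul _).add (integrable_const _)) ?_
      filter_upwards [hg.ae_ne_zero, hg.ae_ne_top, hf.ae_ne_zero, hf.ae_ne_top]
        with x hg0 hgt hf0 hft
      have a := ENNReal.toReal_pos hg0 hgt
      have b := ENNReal.toReal_pos hf0 hft
      have c := Real.log_le_sub_one_of_pos
        (show 0 < h⁻¹ * ((g x).toReal * (f x).toReal⁻¹) by positivity)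
      rw [Real.log_mul (by positivity) (by positivity),
        Real.log_mul (by positivity) (by positivity), Real.log_inv, Real.log_inv] at c
      simp only [ENNReal.rpow_one, ENNReal.toReal_mul, ENNReal.toReal_inv]
      linarith
    rw [integral_sub hg.integrable_log hf.integrable_log,
      integral_add (hi.const_mul _) (integrable_const _), integral_const_mul, hint,
      inv_mul_cancel₀ hHp.ne'] at hle
    simp only [integral_const, probReal_univ, one_smul] at hle
    simp only [logPowerMean, if_true]
    linarith
  · have key : ∫⁻ x, g x ^ (q - 1) ∂μ ≤ (∫⁻ x, g x ^ q * (f x)⁻¹ ∂μ) ^ ((q - 1) / q)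
        * (∫⁻ x, f x ^ (q - 1) ∂μ) ^ (1 / q) := by
      refine le_trans (le_of_eq (lintegral_congr_ae ?_)) (ENNReal.lintegral_mul_norm_pow_le hmH
        (hf.aemeasurable.pow_const (q - 1)) (p := (q - 1) / q) (q := 1 / q)
        (div_nonneg (by linarith) hq.le) (by positivity) (by field_simp; ring))
      filter_upwards [hg.ae_ne_zero, hg.ae_ne_top, hf.ae_ne_zero, hf.ae_ne_top]
        with x hg0 hgt hf0 hft
      rw [ENNReal.mul_rpow_of_nonneg _ _ (div_nonneg (by linarith) hq.le), ENNReal.inv_rpow,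
        ← ENNReal.rpow_neg, ← ENNReal.rpow_mul, ← ENNReal.rpow_mul, mul_assoc,
        ← ENNReal.rpow_add _ _ hf0 hft]
      rw [show -((q - 1) / q) + (q - 1) * (1 / q) = 0 by ring, ENNReal.rpow_zero, mul_one,
        mul_div_cancel₀ _ hq.ne']
    have h2 := ENNReal.toReal_mono (ENNReal.mul_ne_top
      (ENNReal.rpow_ne_top_of_nonneg (div_nonneg (by linarith) hq.le) hH)
      (ENNReal.rpow_ne_top_of_nonneg (by positivity) (hf.lintegral_rpow_ne_top hq))) key
    rw [ENNReal.toReal_mul, ← ENNReal.toReal_rpow, ← ENNReal.toReal_rpow] at h2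
    have h3 := Real.log_le_log hG h2
    rw [Real.log_mul (Real.rpow_pos_of_pos hHp _).ne' (Real.rpow_pos_of_pos hF _).ne',
      Real.log_rpow hHp, Real.log_rpow hF, log_lintegral_rpow, log_lintegral_rpow] at h3
    have h4 : (q - 1) * (q * logPowerMean μ q g) ≤ (q - 1) *
        (Real.log (∫⁻ x, g x ^ q * (f x)⁻¹ ∂μ).toReal + logPowerMean μ q f) := by
      have := mul_le_mul_of_nonneg_left h3 hq.le
      calc _ = q * ((q - 1) * logPowerMean μ q g) := by ring
        _ ≤ _ := this
        _ = _ := by field_simp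
    exact le_of_mul_le_mul_left h4 (by linarith)

theorem neg_log_le_logPowerMean [IsProbabilityMeasure μ] (hf : IsWeight μ f) (hq : 0 < q) :
    -Real.log (∫⁻ x, (f x)⁻¹ ∂μ).toReal ≤ logPowerMean μ q f := by
  have := hf.mul_logPowerMean_le one hq (by simpa using hf.lintegral_inv_ne_top)
  simp only [logPowerMean_one, ENNReal.one_rpow, one_mul, mul_zero] at this
  linarith

theorem logPowerMean_le_of_lintegral_le [IsProbabilityMeasure μ] (hf : IsWeight μ f)
    (hg : IsWeight μ g) (hq : 0 < q)
    (h : ∫⁻ x, g x ^ q * (f x)⁻¹ ∂μ ≤ ∫⁻ x, g x ^ (q - 1) ∂μ) :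
    logPowerMean μ q g ≤ logPowerMean μ q f := by
  have hH := ne_top_of_le_ne_top (hg.lintegral_rpow_ne_top hq) h
  have h1 := hf.mul_logPowerMean_le hg hq hH
  have h2 := Real.log_le_log (ENNReal.toReal_pos (hf.lintegral_rpow_mul_inv_ne_zero hg) hH)
    (ENNReal.toReal_mono (hg.lintegral_rpow_ne_top hq) h)
  rw [log_lintegral_rpow] at h2
  linarith

theorem logPowerMean_le_of_lintegral_le_mul [IsProbabilityMeasure μ] (hf : IsWeight μ f)
    (hg : IsWeight μ g) (hq : 0 < q) {K : ℝ≥0∞} (hK : K ≠ ⊤)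
    (h : ∫⁻ x, g x ^ q * (f x)⁻¹ ∂μ ≤ K * ∫⁻ x, f x ^ (q - 1) ∂μ) :
    logPowerMean μ q g ≤ logPowerMean μ q f + Real.log K.toReal / q := by
  have hF := hf.lintegral_rpow_ne_top hq
  have hKF := ENNReal.mul_ne_top hK hF
  have hH := ne_top_of_le_ne_top hKF h
  have hH0 := hf.lintegral_rpow_mul_inv_ne_zero (q := q) hg
  have h1 := hf.mul_logPowerMean_le hg hq hH
  have hK0 : K ≠ 0 := by
    rintro rfl
    simp only [zero_mul, nonpos_iff_eq_zero] at h
    exact hH0 h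
  have h2 := Real.log_le_log (ENNReal.toReal_pos hH0 hH) (ENNReal.toReal_mono hKF h)
  rw [ENNReal.toReal_mul, Real.log_mul (ENNReal.toReal_pos hK0 hK).ne'
    (ENNReal.toReal_pos hf.lintegral_rpow_ne_zero hF).ne', log_lintegral_rpow] at h2
  rw [← sub_le_iff_le_add', le_div_iff₀ hq]
  linarith

end IsWeight

end RenyiMean

section ScalingLimits

/-- The extended-real scaling rate `u ε / log ε`. -/
noncomputable def logRate (u : ℝ → ℝ) (ε : ℝ) : EReal := ((u ε / Real.log ε : ℝ) : EReal)

theorem tendsto_const_div_log (a : ℝ) :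
    Tendsto (fun ε => a / Real.log ε) (𝓝[>] (0:ℝ)) (𝓝 0) :=
  Real.tendsto_log_nhdsGT_zero.const_div_atBot a

theorem tendsto_const_mul_nhdsGT_zero {c : ℝ} (hc : 0 < c) :
    Tendsto (fun ε => c * ε) (𝓝[>] (0:ℝ)) (𝓝[>] (0:ℝ)) := by
  refine tendsto_nhdsWithin_iff.2 ⟨?_, ?_⟩
  · have : Tendsto (fun ε : ℝ => c * ε) (𝓝 0) (𝓝 (c * 0)) := tendsto_id.const_mul c
    rw [mul_zero] at this
    exact this.mono_left nhdsWithin_le_nhds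
  · filter_upwards [self_mem_nhdsWithin] with ε hε
    exact mul_pos hc hε

theorem map_const_mul_nhdsGT_zero {c : ℝ} (hc : 0 < c) :
    map (fun ε => c * ε) (𝓝[>] (0:ℝ)) = 𝓝[>] (0:ℝ) := by
  refine le_antisymm (tendsto_const_mul_nhdsGT_zero hc) ?_
  calc 𝓝[>] (0:ℝ) = map (fun ε => c * ε) (map (fun ε => c⁻¹ * ε) (𝓝[>] (0:ℝ))) := by
        simp [map_map, Function.comp_def, mul_inv_cancel_left₀ hc.ne']
    _ ≤ map (fun ε => c * ε) (𝓝[>] (0:ℝ)) :=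
        map_mono (tendsto_const_mul_nhdsGT_zero (inv_pos.2 hc))

theorem eventually_logRate_le {u v : ℝ → ℝ} {c K M : ℝ} (hc : 0 < c)
    (hv : ∀ᶠ ε in 𝓝[>] (0:ℝ), |v ε / Real.log ε| ≤ M)
    (h : ∀ᶠ ε in 𝓝[>] (0:ℝ), v (c * ε) ≤ u ε + K) :
    ∃ e : ℝ → EReal, Tendsto e (𝓝[>] (0:ℝ)) (𝓝 0) ∧
      ∀ᶠ ε in 𝓝[>] (0:ℝ), logRate u ε ≤ logRate v (c * ε) + e ε := by
  refine ⟨fun ε => (((M * |Real.log c| + |K|) / -Real.log ε : ℝ) : EReal), ?_, ?_⟩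
  · have := (tendsto_const_div_log (-(M * |Real.log c| + |K|)))
    simp only [neg_div, ← div_neg] at this
    exact_mod_cast (continuous_coe_real_ereal.tendsto 0).comp this
  · have hv' : ∀ᶠ ε in 𝓝[>] (0:ℝ), |v (c * ε) / Real.log (c * ε)| ≤ M := by
      rw [← map_const_mul_nhdsGT_zero hc] at hv
      exact hv
    have hlog : ∀ᶠ ε in 𝓝[>] (0:ℝ), Real.log (c * ε) < 0 := by
      have := Real.tendsto_log_nhdsGT_zero.eventually_lt_atBot 0
      rw [← map_const_mul_nhdsGT_zero hc] at this
      exact this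
    filter_upwards [hv', hlog, h, Real.tendsto_log_nhdsGT_zero.eventually_lt_atBot 0,
      self_mem_nhdsWithin] with ε h1 h2 h3 h4 hε
    simp only [logRate]
    rw [← EReal.coe_add, EReal.coe_le_coe_iff]
    have hl : Real.log (c * ε) = Real.log c + Real.log ε := Real.log_mul hc.ne' (ne_of_gt hε)
    set w := v (c * ε) / Real.log (c * ε) with hw
    have hvw : v (c * ε) = w * (Real.log c + Real.log ε) := by
      rw [← hl, hw, div_mul_cancel₀ _ h2.ne]
    have e1 : w * Real.log c ≥ -(M * |Real.log c|) := by
      have := abs_mul w (Real.log c)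
      have := neg_abs_le (w * Real.log c)
      have := mul_le_mul_of_nonneg_right h1 (abs_nonneg (Real.log c))
      linarith
    rw [div_neg, ← sub_eq_add_neg, div_le_iff_of_neg h4, sub_mul, div_mul_cancel₀ _ h4.ne]
    have := le_abs_self K
    linarith

theorem limsup_logRate_le {u v : ℝ → ℝ} {c K M : ℝ} (hc : 0 < c)
    (hv : ∀ᶠ ε in 𝓝[>] (0:ℝ), |v ε / Real.log ε| ≤ M)
    (h : ∀ᶠ ε in 𝓝[>] (0:ℝ), v (c * ε) ≤ u ε + K) :
    limsup (logRate u) (𝓝[>] (0:ℝ)) ≤ limsup (logRate v) (𝓝[>] (0:ℝ)) := by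
  obtain ⟨e, he, hle⟩ := eventually_logRate_le hc hv h
  calc limsup (logRate u) (𝓝[>] (0:ℝ))
      ≤ limsup ((logRate v ∘ fun ε => c * ε) + e) (𝓝[>] (0:ℝ)) := limsup_le_limsup hle
    _ ≤ limsup (logRate v ∘ fun ε => c * ε) (𝓝[>] (0:ℝ)) + limsup e (𝓝[>] (0:ℝ)) :=
        EReal.limsup_add_le (by simp [he.limsup_eq]) (by simp [he.limsup_eq])
    _ = limsup (logRate v) (𝓝[>] (0:ℝ)) := by
        rw [he.limsup_eq, add_zero, limsup_comp, map_const_mul_nhdsGT_zero hc]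

theorem liminf_logRate_le {u v : ℝ → ℝ} {c K M : ℝ} (hc : 0 < c)
    (hv : ∀ᶠ ε in 𝓝[>] (0:ℝ), |v ε / Real.log ε| ≤ M)
    (h : ∀ᶠ ε in 𝓝[>] (0:ℝ), v (c * ε) ≤ u ε + K) :
    liminf (logRate u) (𝓝[>] (0:ℝ)) ≤ liminf (logRate v) (𝓝[>] (0:ℝ)) := by
  obtain ⟨e, he, hle⟩ := eventually_logRate_le hc hv h
  calc liminf (logRate u) (𝓝[>] (0:ℝ))
      ≤ liminf (e + (logRate v ∘ fun ε => c * ε)) (𝓝[>] (0:ℝ)) :=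
        liminf_le_liminf (hle.mono fun ε hε => hε.trans_eq (add_comm _ _))
    _ ≤ limsup e (𝓝[>] (0:ℝ)) + liminf (logRate v ∘ fun ε => c * ε) (𝓝[>] (0:ℝ)) :=
        EReal.liminf_add_le (by simp [he.limsup_eq]) (by simp [he.limsup_eq])
    _ = liminf (logRate v) (𝓝[>] (0:ℝ)) := by
        rw [he.limsup_eq, zero_add, liminf_comp, map_const_mul_nhdsGT_zero hc]

variable {α : Type*} [MeasurableSpace α] {μ : Measure α}

/-- A family of weights whose inverses have integrals growing at most polynomially in `ε⁻¹`. -/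
def IsModerate (μ : Measure α) (f : ℝ → α → ℝ≥0∞) : Prop :=
  ∃ m : ℕ, ∀ᶠ ε in 𝓝[>] (0:ℝ),
    IsWeight μ (f ε) ∧ ∫⁻ x, (f ε x)⁻¹ ∂μ ≤ ENNReal.ofReal (ε⁻¹ ^ m)

theorem IsModerate.eventually_isWeight {f : ℝ → α → ℝ≥0∞} (hf : IsModerate μ f) :
    ∀ᶠ ε in 𝓝[>] (0:ℝ), IsWeight μ (f ε) :=
  let ⟨_, h⟩ := hf
  h.mono fun _ h => h.1

variable [IsProbabilityMeasure μ] {f : ℝ → α → ℝ≥0∞} {q : ℝ}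

theorem IsModerate.abs_div_log_le (hf : IsModerate μ f) (hq : 0 < q) :
    ∃ M : ℝ, ∀ᶠ ε in 𝓝[>] (0:ℝ), |logPowerMean μ q (f ε) / Real.log ε| ≤ M := by
  obtain ⟨m, hm⟩ := hf
  refine ⟨m, ?_⟩
  filter_upwards [hm, Real.tendsto_log_nhdsGT_zero.eventually_lt_atBot 0,
    self_mem_nhdsWithin] with ε h1 h2 hε
  obtain ⟨hw, hb⟩ := h1
  have hε' : (0:ℝ) < ε := hε
  have h3 := hw.neg_log_le_logPowerMean hq
  have h4 := hw.logPowerMean_nonpos hq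
  have h0 : ∫⁻ x, (f ε x)⁻¹ ∂μ ≠ 0 := by
    simpa using hw.lintegral_rpow_mul_inv_ne_zero (q := 0) hw
  have h5 := ENNReal.toReal_mono ENNReal.ofReal_ne_top hb
  rw [ENNReal.toReal_ofReal (by positivity)] at h5
  have h6 := Real.log_le_log (ENNReal.toReal_pos h0 hw.lintegral_inv_ne_top) h5
  rw [Real.log_pow, Real.log_inv] at h6
  rw [abs_of_nonneg (div_nonneg_of_nonpos h4 h2.le), div_le_iff_of_neg h2]
  linarith

variable {F : ℝ → ℝ≥0∞} {Flog : ℝ → ℝ}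

theorem IsModerate.dimScale_eventuallyEq (hf : IsModerate μ f) (hq : 0 < q) (hq1 : q ≠ 1)
    (hF : ∀ᶠ ε in 𝓝[>] (0:ℝ), F ε = ∫⁻ x, f ε x ^ (q - 1) ∂μ) :
    dimScale F q =ᶠ[𝓝[>] (0:ℝ)] logRate fun ε => logPowerMean μ q (f ε) := by
  obtain ⟨m, hm⟩ := hf
  filter_upwards [hm, hF] with ε h1 h2
  simp only [dimScale, logRate, elog, h2, if_neg h1.1.lintegral_rpow_ne_zero,
    if_neg (h1.1.lintegral_rpow_ne_top hq), logPowerMean, if_neg hq1]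
  rw [← EReal.coe_mul, mul_inv, div_eq_mul_inv]
  congr 1
  ring

theorem IsModerate.dimPlus_eq (hf : IsModerate μ f) (hq : 0 < q)
    (hF : ∀ᶠ ε in 𝓝[>] (0:ℝ), F ε = ∫⁻ x, f ε x ^ (q - 1) ∂μ)
    (hFlog : ∀ᶠ ε in 𝓝[>] (0:ℝ), Flog ε = ∫ x, Real.log (f ε x).toReal ∂μ) :
    dimPlus F Flog q = limsup (logRate fun ε => logPowerMean μ q (f ε)) (𝓝[>] (0:ℝ)) := by
  by_cases h : q = 1
  · obtain ⟨M, hM⟩ := hf.abs_div_log_le hq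
    have heq : (fun ε => Flog ε / Real.log ε)
        =ᶠ[𝓝[>] (0:ℝ)] fun ε => logPowerMean μ q (f ε) / Real.log ε := by
      filter_upwards [hFlog] with ε hε
      simp only [hε, logPowerMean, h, if_true]
    rw [dimPlus, if_pos h, limsup_congr heq]
    exact EReal.coe_strictMono.monotone.map_limsup_of_continuousAt _
      continuous_coe_real_ereal.continuousAt
      (isBoundedUnder_of_eventually_le (hM.mono fun ε hε => (abs_le.1 hε).2))
      (isBoundedUnder_of_eventually_ge (hM.mono fun ε hε => (abs_le.1 hε).1)).isCoboundedUnder_le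
  · rw [dimPlus, if_neg h]
    exact limsup_congr (hf.dimScale_eventuallyEq hq h hF)

theorem IsModerate.dimMinus_eq (hf : IsModerate μ f) (hq : 0 < q)
    (hF : ∀ᶠ ε in 𝓝[>] (0:ℝ), F ε = ∫⁻ x, f ε x ^ (q - 1) ∂μ)
    (hFlog : ∀ᶠ ε in 𝓝[>] (0:ℝ), Flog ε = ∫ x, Real.log (f ε x).toReal ∂μ) :
    dimMinus F Flog q = liminf (logRate fun ε => logPowerMean μ q (f ε)) (𝓝[>] (0:ℝ)) := by
  by_cases h : q = 1
  · obtain ⟨M, hM⟩ := hf.abs_div_log_le hq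
    have heq : (fun ε => Flog ε / Real.log ε)
        =ᶠ[𝓝[>] (0:ℝ)] fun ε => logPowerMean μ q (f ε) / Real.log ε := by
      filter_upwards [hFlog] with ε hε
      simp only [hε, logPowerMean, h, if_true]
    rw [dimMinus, if_pos h, liminf_congr heq]
    exact EReal.coe_strictMono.monotone.map_liminf_of_continuousAt _
      continuous_coe_real_ereal.continuousAt
      (isBoundedUnder_of_eventually_le (hM.mono fun ε hε => (abs_le.1 hε).2)).isCoboundedUnder_ge
      (isBoundedUnder_of_eventually_ge (hM.mono fun ε hε => (abs_le.1 hε).1))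
  · rw [dimMinus, if_neg h]
    exact liminf_congr (hf.dimScale_eventuallyEq hq h hF)

end ScalingLimits

section ReturnTimes

variable {α : Type*} {T : α → α}

theorem firstReturn_pos {A : Set α} {x : α} {k : ℕ} (hk : 0 < k) (h : T^[k] x ∈ A) :
    0 < firstReturn T A x :=
  (Nat.sInf_mem (s := {k : ℕ | 0 < k ∧ T^[k] x ∈ A}) ⟨k, hk, h⟩).1

theorem iterate_firstReturn_mem {A : Set α} {x : α} (h : 0 < firstReturn T A x) :
    T^[firstReturn T A x] x ∈ A :=
  (Nat.sInf_mem (Nat.nonempty_of_pos_sInf h)).2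

theorem firstReturn_anti {A B : Set α} {x : α} (hAB : A ⊆ B) (h : 0 < firstReturn T A x) :
    firstReturn T B x ≤ firstReturn T A x :=
  Nat.sInf_le ⟨h, hAB (iterate_firstReturn_mem h)⟩

variable [MeasurableSpace α] {μ : Measure α}

theorem measurable_firstReturn (hT : Measurable T) {A : α → Set α}
    (hA : MeasurableSet {p : α × α | p.2 ∈ A p.1}) :
    Measurable fun x => firstReturn T (A x) x := by
  have hP : ∀ k : ℕ, MeasurableSet {x | 0 < k ∧ T^[k] x ∈ A x} := by
    intro k
    by_cases hk : 0 < k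
    · simpa [hk] using (measurable_id.prodMk (hT.iterate k)) hA
    · simp [hk]
  refine measurable_of_Iio fun m => ?_
  have : (fun x => firstReturn T (A x) x) ⁻¹' Set.Iio m =
      if 0 < m then (⋂ k : ℕ, {x | 0 < k ∧ T^[k] x ∈ A x}ᶜ) ∪
        ⋃ k ∈ Set.Iio m, {x | 0 < k ∧ T^[k] x ∈ A x} else ∅ := by
    ext x
    by_cases hm : 0 < m
    · simp only [Set.mem_preimage, Set.mem_Iio, hm, if_true, Set.mem_union, Set.mem_iInter,
        Set.mem_iUnion, Set.mem_compl_iff]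
      constructor
      · intro h
        by_cases h0 : 0 < firstReturn T (A x) x
        · exact Or.inr ⟨_, h, h0, iterate_firstReturn_mem h0⟩
        · exact Or.inl fun k hk => h0 (firstReturn_pos hk.1 hk.2)
      · rintro (h | ⟨k, hkm, hk⟩)
        · rwa [firstReturn, Set.eq_empty_of_forall_notMem (s := {k | 0 < k ∧ T^[k] x ∈ A x}) h,
            Nat.sInf_empty]
        · exact (Nat.sInf_le hk).trans_lt hkm
    · simp [Nat.eq_zero_of_not_pos hm]
  rw [this]
  split_ifs
  · exact (MeasurableSet.iInter fun k => (hP k).compl).union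
      (MeasurableSet.biUnion (Set.to_countable _) fun k _ => hP k)
  · exact MeasurableSet.empty

/-- Kac's inequality: the mean return time to `A`, integrated over `A`, is at most one. -/
theorem setLIntegral_firstReturn_le_one [IsProbabilityMeasure μ] (hT : MeasurePreserving T μ μ)
    {A : Set α} (hA : MeasurableSet A) :
    ∫⁻ x in A, (firstReturn T A x : ℝ≥0∞) ∂μ ≤ 1 := by
  set C : ℕ → Set α := fun k => ⋂ i ∈ Set.Iio k, T^[i] ⁻¹' Aᶜ with hC
  have hCm : ∀ k, MeasurableSet (C k) := fun k =>
    MeasurableSet.biInter (Set.to_countable _) fun i _ => hT.measurable.iterate i hA.compl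
  set D : ℕ → Set α := fun k => T ⁻¹' C k with hD
  have hDm : ∀ k, MeasurableSet (D k) := fun k => hT.measurable (hCm k)
  have hstep : ∀ k, μ (C k) = μ (D k ∩ A) + μ (C (k + 1)) := by
    intro k
    rw [← hT.measure_preimage (hCm k).nullMeasurableSet, ← measure_inter_add_sdiff _ hA]
    congr 2
    ext x
    simp only [hC, Set.mem_sdiff, Set.mem_preimage, Set.mem_iInter, Set.mem_Iio,
      Set.mem_compl_iff, ← Function.iterate_succ_apply]
    constructor
    · rintro ⟨h, hx⟩ (_ | i) hi
      · exact hx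
      · exact h i (by omega)
    · exact fun h => ⟨fun i hi => h (i + 1) (by omega), h 0 (by omega)⟩
  have hsum : ∀ N, ∑ k ∈ Finset.range N, μ (D k ∩ A) + μ (C N) = 1 := by
    intro N
    induction N with
    | zero => simp [hC]
    | succ N ih => rw [Finset.sum_range_succ, add_assoc, ← hstep, ih]
  have hle : ∀ x, (firstReturn T A x : ℝ≥0∞) ≤ ∑' k, (D k).indicator 1 x := by
    intro x
    calc (firstReturn T A x : ℝ≥0∞)
        = ∑ k ∈ Finset.range (firstReturn T A x), (1 : ℝ≥0∞) := by simp
      _ = ∑ k ∈ Finset.range (firstReturn T A x), (D k).indicator 1 x := by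
          refine Finset.sum_congr rfl fun k hk => ?_
          rw [Set.indicator_of_mem, Pi.one_apply]
          simp only [hD, hC, Set.mem_preimage, Set.mem_iInter, Set.mem_Iio, Set.mem_compl_iff,
            ← Function.iterate_succ_apply]
          intro i hi hmem
          have : firstReturn T A x ≤ i + 1 := Nat.sInf_le ⟨i.succ_pos, hmem⟩
          have := Finset.mem_range.1 hk
          omega
      _ ≤ _ := ENNReal.sum_le_tsum _
  calc ∫⁻ x in A, (firstReturn T A x : ℝ≥0∞) ∂μ
      ≤ ∫⁻ x in A, ∑' k, (D k).indicator 1 x ∂μ := lintegral_mono hle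
    _ = ∑' k, μ (D k ∩ A) := by
        rw [lintegral_tsum fun k => (measurable_one.indicator (hDm k)).aemeasurable]
        refine tsum_congr fun k => ?_
        rw [lintegral_indicator_one (hDm k), Measure.restrict_apply (hDm k)]
    _ ≤ 1 := by
        refine ENNReal.tsum_le_of_sum_range_le fun N => ?_
        rw [← hsum N]
        exact le_self_add

theorem ae_firstReturn_pos [IsProbabilityMeasure μ] (hT : MeasurePreserving T μ μ)
    {A : Set α} (hA : MeasurableSet A) : ∀ᵐ x ∂μ, x ∈ A → 0 < firstReturn T A x := by
  filter_upwards [hT.conservative.ae_mem_imp_frequently_image_mem hA.nullMeasurableSet]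
    with x hx hxA
  obtain ⟨k, hk, hmem⟩ := (frequently_atTop.1 (hx hxA)) 1
  exact firstReturn_pos hk hmem

end ReturnTimes

section GridCells

variable {n : ℕ} {μ : Measure (Euc n)} {ε : ℝ}

/-- Index of the cube of side `ε` containing `x`. -/
noncomputable def Grid.index (θ : Grid n) (ε : ℝ) (x : Euc n) : Fin n → ℤ :=
  fun i => ⌊θ.coords x i / ε⌋

/-- The cube of side `ε` containing `x`. -/
noncomputable def Grid.cell (θ : Grid n) (ε : ℝ) (x : Euc n) : Set (Euc n) :=
  θ.box ε (θ.index ε x)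

namespace Grid

variable (θ : Grid n)

theorem mem_box_iff (hε : 0 < ε) {x : Euc n} {j : Fin n → ℤ} :
    x ∈ θ.box ε j ↔ θ.index ε x = j := by
  simp only [box, index, Set.mem_ofPred_eq, funext_iff, Int.floor_eq_iff, le_div_iff₀ hε,
    div_lt_iff₀ hε]

theorem mem_cell_iff (hε : 0 < ε) {x y : Euc n} :
    y ∈ θ.cell ε x ↔ θ.index ε y = θ.index ε x :=
  θ.mem_box_iff hε

theorem cell_eq_box (hε : 0 < ε) {x : Euc n} {j : Fin n → ℤ} (h : x ∈ θ.box ε j) :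
    θ.cell ε x = θ.box ε j := by
  rw [cell, (θ.mem_box_iff hε).1 h]

theorem coords_sub (x y : Euc n) (i : Fin n) :
    θ.coords x i - θ.coords y i = θ.rot.symm (x - y) i := by
  simp only [coords]
  rw [← PiLp.sub_apply, ← map_sub, sub_sub_sub_cancel_right]

theorem abs_coords_sub_le (x y : Euc n) (i : Fin n) :
    |θ.coords x i - θ.coords y i| ≤ dist x y := by
  rw [coords_sub, dist_eq_norm, ← θ.rot.symm.norm_map (x - y), ← Real.norm_eq_abs]
  exact PiLp.norm_apply_le _ i

theorem measurable_index : Measurable (θ.index ε) := by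
  refine measurable_pi_lambda _ fun i => Int.measurable_floor.comp (Measurable.div_const ?_ ε)
  have h : Continuous fun x : Euc n => θ.rot.symm (x - θ.origin) i := by fun_prop
  exact h.measurable

theorem measurableSet_box (hε : 0 < ε) (j : Fin n → ℤ) : MeasurableSet (θ.box ε j) := by
  have : θ.box ε j = θ.index ε ⁻¹' {j} := by
    ext x
    exact θ.mem_box_iff hε
  rw [this]
  exact θ.measurable_index (measurableSet_singleton j)

theorem measurableSet_cell (hε : 0 < ε) :
    MeasurableSet {p : Euc n × Euc n | p.2 ∈ θ.cell ε p.1} := by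
  simp only [θ.mem_cell_iff hε]
  exact ((θ.measurable_index.comp measurable_snd).prodMk (θ.measurable_index.comp measurable_fst))
    (Set.to_countable {p : (Fin n → ℤ) × (Fin n → ℤ) | p.1 = p.2}).measurableSet

theorem iUnion_box (hε : 0 < ε) : ⋃ j, θ.box ε j = Set.univ :=
  Set.eq_univ_of_forall fun _ => Set.mem_iUnion.2 ⟨_, (θ.mem_box_iff hε).2 rfl⟩

theorem pairwise_disjoint_box (hε : 0 < ε) : Pairwise (Function.onFun Disjoint (θ.box ε)) := by
  intro i j hij
  refine Set.disjoint_left.2 fun x hi hj => hij ?_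
  rw [← (θ.mem_box_iff hε).1 hi, (θ.mem_box_iff hε).1 hj]

theorem lintegral_eq_tsum (hε : 0 < ε) (F : Euc n → ℝ≥0∞) :
    ∫⁻ x, F x ∂μ = ∑' j, ∫⁻ x in θ.box ε j, F x ∂μ := by
  rw [← lintegral_iUnion (θ.measurableSet_box hε) (θ.pairwise_disjoint_box hε),
    θ.iUnion_box hε, Measure.restrict_univ]

theorem integral_eq_tsum (hε : 0 < ε) {F : Euc n → ℝ} (hF : Integrable F μ) :
    ∫ x, F x ∂μ = ∑' j, ∫ x in θ.box ε j, F x ∂μ := by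
  rw [← integral_iUnion (θ.measurableSet_box hε) (θ.pairwise_disjoint_box hε) hF.integrableOn,
    θ.iUnion_box hε, Measure.restrict_univ]

theorem cell_subset_ball {δ : ℝ} (hδ : 0 < δ) (h : (n + 1) * δ ≤ ε) (x : Euc n) :
    θ.cell δ x ⊆ Metric.ball x ε := by
  intro y hy
  rw [θ.mem_cell_iff hδ] at hy
  have hi : ∀ i, ‖θ.rot.symm (y - x) i‖ ^ 2 ≤ δ ^ 2 := by
    intro i
    have h1 := Int.abs_sub_lt_one_of_floor_eq_floor (congrFun hy i)
    rw [← sub_div, abs_div, abs_of_pos hδ, div_lt_one hδ, coords_sub] at h1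
    rw [Real.norm_eq_abs]
    exact pow_le_pow_left₀ (abs_nonneg _) h1.le 2
  have hs : ∑ i, ‖θ.rot.symm (y - x) i‖ ^ 2 ≤ n * δ ^ 2 := by
    simpa using Finset.sum_le_card_nsmul Finset.univ _ _ fun i _ => hi i
  rw [Metric.mem_ball, dist_eq_norm, ← θ.rot.symm.norm_map (y - x), EuclideanSpace.norm_eq]
  have hn : (0:ℝ) ≤ n := Nat.cast_nonneg n
  rw [Real.sqrt_lt' (by nlinarith)]
  calc _ ≤ n * δ ^ 2 := hs
    _ < ((n + 1) * δ) ^ 2 := by nlinarith [mul_pos hδ hδ]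
    _ ≤ ε ^ 2 := pow_le_pow_left₀ (by positivity) h 2

/-- Offsets of the cubes adjacent to a given one. -/
noncomputable def offsets (n : ℕ) : Finset (Fin n → ℤ) :=
  Fintype.piFinset fun _ => Finset.Icc (-1) 1

theorem ball_subset_biUnion_box (hε : 0 < ε) {x : Euc n} {j : Fin n → ℤ} (hx : x ∈ θ.box ε j) :
    Metric.ball x ε ⊆ ⋃ s ∈ offsets n, θ.box ε (j + s) := by
  intro y hy
  rw [θ.mem_box_iff hε] at hx
  refine Set.mem_biUnion (x := θ.index ε y - j) ?_ ((θ.mem_box_iff hε).2 (by simp))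
  simp only [offsets, SetLike.mem_coe, Fintype.mem_piFinset, Finset.mem_Icc, Pi.sub_apply]
  intro i
  have h1 : |θ.coords y i / ε - θ.coords x i / ε| < 1 := by
    rw [← sub_div, abs_div, abs_of_pos hε, div_lt_one hε]
    exact (θ.abs_coords_sub_le y x i).trans_lt hy
  have h2 := abs_lt.1 h1
  rw [← hx]
  simp only [index]
  have a1 := Int.floor_le (θ.coords y i / ε)
  have a2 := Int.lt_floor_add_one (θ.coords y i / ε)
  have b1 := Int.floor_le (θ.coords x i / ε)
  have b2 := Int.lt_floor_add_one (θ.coords x i / ε)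
  constructor
  · have : (⌊θ.coords x i / ε⌋ : ℝ) < ⌊θ.coords y i / ε⌋ + 2 := by linarith
    have : ⌊θ.coords x i / ε⌋ < ⌊θ.coords y i / ε⌋ + 2 := by exact_mod_cast this
    omega
  · have : (⌊θ.coords y i / ε⌋ : ℝ) < ⌊θ.coords x i / ε⌋ + 2 := by linarith
    have : ⌊θ.coords y i / ε⌋ < ⌊θ.coords x i / ε⌋ + 2 := by exact_mod_cast this
    omega

/-- A compactly supported measure charges polynomially many cubes. -/
theorem exists_finset_box_null [IsProbabilityMeasure μ] {X : Set (Euc n)} (hXc : IsCompact X)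
    (hX : μ X = 1) :
    ∃ m : ℕ, ∀ᶠ ε in 𝓝[>] (0:ℝ), ∃ S : Finset (Fin n → ℤ),
      (∀ j ∉ S, μ (θ.box ε j) = 0) ∧ (S.card : ℝ) ≤ ε⁻¹ ^ m := by
  obtain ⟨R, hR0, hR⟩ := hXc.isBounded.subset_closedBall_lt 0 θ.origin
  have hXn : μ Xᶜ = 0 := by
    rw [prob_compl_eq_zero_iff hXc.measurableSet, hX]
  refine ⟨2 * n, ?_⟩
  have hpos : (0:ℝ) < (2 * R + 5)⁻¹ := by positivity
  filter_upwards [Ioo_mem_nhdsGT hpos] with ε hε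
  have hε0 : 0 < ε := hε.1
  have hε1 : (2 * R + 5) ≤ ε⁻¹ := by
    rw [le_inv_comm₀ (by positivity) hε0]
    exact hε.2.le
  have hone : 1 ≤ ε⁻¹ := by linarith
  refine ⟨Fintype.piFinset fun _ => Finset.Icc (-(⌈R / ε⌉ + 1)) (⌈R / ε⌉ + 1), ?_, ?_⟩
  · intro j hj
    refine measure_mono_null (t := Xᶜ) (fun x hx (hxX : x ∈ X) => hj ?_) hXn
    rw [θ.mem_box_iff hε0] at hx
    simp only [Fintype.mem_piFinset, Finset.mem_Icc]
    intro i
    have h1 : |θ.coords x i| ≤ R := by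
      have := θ.abs_coords_sub_le x θ.origin i
      have h0 : θ.coords θ.origin i = 0 := by simp [coords]
      rw [h0, sub_zero] at this
      exact this.trans (hR hxX)
    have h2 := abs_le.1 h1
    have h3 : θ.coords x i / ε ≤ R / ε := by gcongr; exact h2.2
    have h4 : -(R / ε) ≤ θ.coords x i / ε := by rw [← neg_div]; gcongr; exact h2.1
    have h5 := Int.le_ceil (R / ε)
    rw [← hx]
    simp only [index]
    constructor
    · refine Int.le_floor.2 ?_
      push_cast
      linarith
    · have := Int.floor_le (θ.coords x i / ε)
      have : (⌊θ.coords x i / ε⌋ : ℝ) ≤ ((⌈R / ε⌉ + 1 : ℤ) : ℝ) := by push_cast; linarith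
      exact_mod_cast this
  · have hc : 0 ≤ ⌈R / ε⌉ := Int.ceil_nonneg (by positivity)
    have hcard : (((Finset.Icc (-(⌈R / ε⌉ + 1)) (⌈R / ε⌉ + 1)).card : ℕ) : ℝ)
        = 2 * ⌈R / ε⌉ + 3 := by
      rw [Int.card_Icc]
      have : (((⌈R / ε⌉ + 1 + 1 - -(⌈R / ε⌉ + 1)).toNat : ℤ) : ℝ) = 2 * ⌈R / ε⌉ + 3 := by
        rw [Int.toNat_of_nonneg (by omega)]
        push_cast
        ring
      exact_mod_cast this
    rw [Fintype.card_piFinset]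
    simp only [Finset.prod_const, Finset.card_univ, Fintype.card_fin, Nat.cast_pow, pow_mul]
    refine pow_le_pow_left₀ (Nat.cast_nonneg _) ?_ n
    rw [hcard]
    have h5 := (Int.ceil_lt_add_one (R / ε)).le
    calc (2 * ⌈R / ε⌉ + 3 : ℝ) ≤ 2 * (R / ε + 1) + 3 := by linarith
      _ = 2 * R * ε⁻¹ + 5 := by ring
      _ ≤ (2 * R + 5) * ε⁻¹ := by nlinarith
      _ ≤ ε⁻¹ ^ 2 := by rw [sq]; gcongr

theorem lintegral_le_card (hε : 0 < ε) {S : Finset (Fin n → ℤ)}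
    (hS : ∀ j ∉ S, μ (θ.box ε j) = 0) {F : Euc n → ℝ≥0∞}
    (hF : ∀ j, ∫⁻ x in θ.box ε j, F x ∂μ ≤ 1) : ∫⁻ x, F x ∂μ ≤ S.card := by
  rw [θ.lintegral_eq_tsum hε,
    tsum_eq_sum (s := S) fun j hj => setLIntegral_measure_zero _ _ (hS j hj)]
  simpa using Finset.sum_le_sum fun j (_ : j ∈ S) => hF j

end Grid

end GridCells

section Weights

/-- The weight `x ↦ μ (A x)` of a family of neighbourhoods. -/
noncomputable def measureWeight {α : Type*} [MeasurableSpace α] (μ : Measure α)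
    (A : α → Set α) (x : α) : ℝ≥0∞ := μ (A x)

/-- The weight `x ↦ τ_{A x}(x)⁻¹` of a family of neighbourhoods. -/
noncomputable def returnWeight {α : Type*} (T : α → α) (A : α → Set α) (x : α) : ℝ≥0∞ :=
  (firstReturn T (A x) x : ℝ≥0∞)⁻¹

section General

variable {α : Type*} {A : α → Set α} {T : α → α}

theorem returnWeight_le_one {x : α} (h : 0 < firstReturn T (A x) x) :
    returnWeight T A x ≤ 1 := by
  rw [returnWeight, ENNReal.inv_le_one]
  exact_mod_cast h

theorem returnWeight_mono {B : α → Set α} {x : α} (hAB : A x ⊆ B x)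
    (h : 0 < firstReturn T (A x) x) : returnWeight T A x ≤ returnWeight T B x := by
  rw [returnWeight, returnWeight, ENNReal.inv_le_inv]
  exact_mod_cast firstReturn_anti hAB h

theorem returnWeight_rpow (x : α) (q : ℝ) :
    returnWeight T A x ^ (q - 1) = (firstReturn T (A x) x : ℝ≥0∞) ^ (1 - q) := by
  rw [returnWeight, ENNReal.inv_rpow, ← ENNReal.rpow_neg, neg_sub]

theorem toReal_returnWeight (x : α) :
    (returnWeight T A x).toReal = (firstReturn T (A x) x : ℝ)⁻¹ := by
  simp [returnWeight]

variable [MeasurableSpace α] {μ : Measure α}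

theorem measurable_measureWeight [SFinite μ] (hA : MeasurableSet {p : α × α | p.2 ∈ A p.1}) :
    Measurable (measureWeight μ A) :=
  measurable_measure_prodMk_left hA

theorem measurable_returnWeight (hT : Measurable T)
    (hA : MeasurableSet {p : α × α | p.2 ∈ A p.1}) : Measurable (returnWeight T A) :=
  ((measurable_of_countable (fun k : ℕ => (k : ℝ≥0∞)⁻¹)).comp (measurable_firstReturn hT hA))

end General

variable {n : ℕ} {μ : Measure (Euc n)} {ε : ℝ} {T : Euc n → Euc n}
  {S : Finset (Fin n → ℤ)}

theorem measurableSet_mem_ball (ε : ℝ) :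
    MeasurableSet {p : Euc n × Euc n | p.2 ∈ Metric.ball p.1 ε} :=
  measurableSet_lt (measurable_snd.dist measurable_fst) measurable_const

namespace Grid

variable (θ : Grid n)

theorem setLIntegral_box_cell (hε : 0 < ε) (j : Fin n → ℤ) (F : Set (Euc n) → Euc n → ℝ≥0∞) :
    ∫⁻ x in θ.box ε j, F (θ.cell ε x) x ∂μ = ∫⁻ x in θ.box ε j, F (θ.box ε j) x ∂μ :=
  setLIntegral_congr_fun (θ.measurableSet_box hε j) fun x hx => by
    simp only [θ.cell_eq_box hε hx]

theorem setIntegral_box_cell (hε : 0 < ε) (j : Fin n → ℤ) (F : Set (Euc n) → Euc n → ℝ) :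
    ∫ x in θ.box ε j, F (θ.cell ε x) x ∂μ = ∫ x in θ.box ε j, F (θ.box ε j) x ∂μ :=
  setIntegral_congr_fun (θ.measurableSet_box hε j) fun x hx => by
    simp only [θ.cell_eq_box hε hx]

theorem cell_subset_ball_mul (hε : 0 < ε) (x : Euc n) :
    θ.cell ((n + 1 : ℝ)⁻¹ * ε) x ⊆ Metric.ball x ε := by
  have hn : (0:ℝ) < n + 1 := by positivity
  exact θ.cell_subset_ball (by positivity) (mul_inv_cancel_left₀ hn.ne' ε).le x

theorem measureWeight_cell_le_ball (hε : 0 < ε) (x : Euc n) :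
    measureWeight μ (θ.cell ((n + 1 : ℝ)⁻¹ * ε)) x
      ≤ measureWeight μ (fun x => Metric.ball x ε) x :=
  measure_mono (θ.cell_subset_ball_mul hε x)

theorem lintegral_measureWeight_cell_inv_le (hε : 0 < ε) (hS : ∀ j ∉ S, μ (θ.box ε j) = 0) :
    ∫⁻ x, (measureWeight μ (θ.cell ε) x)⁻¹ ∂μ ≤ S.card := by
  refine θ.lintegral_le_card hε hS fun j => ?_
  simp only [measureWeight]
  rw [θ.setLIntegral_box_cell hε j fun A _ => (μ A)⁻¹, setLIntegral_const]
  exact ENNReal.inv_mul_le_one _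

theorem boxRetPF_eq (hε : 0 < ε) (q : ℝ) :
    boxRetPF T μ θ ε q = ∫⁻ x, returnWeight T (θ.cell ε) x ^ (q - 1) ∂μ := by
  rw [θ.lintegral_eq_tsum hε, boxRetPF]
  refine tsum_congr fun j => ?_
  simp only [returnWeight_rpow]
  rw [θ.setLIntegral_box_cell hε j fun A x => (firstReturn T A x : ℝ≥0∞) ^ (1 - q)]

theorem boxMeasPFlog_eq (hε : 0 < ε) (hw : IsWeight μ (measureWeight μ (θ.cell ε))) :
    boxMeasPFlog μ θ ε = ∫ x, Real.log (measureWeight μ (θ.cell ε) x).toReal ∂μ := by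
  rw [θ.integral_eq_tsum hε hw.integrable_log, boxMeasPFlog]
  refine tsum_congr fun j => ?_
  simp only [measureWeight]
  rw [θ.setIntegral_box_cell hε j fun A _ => Real.log (μ A).toReal, setIntegral_const, smul_eq_mul,
    measureReal_def]

theorem boxRetPFlog_eq (hε : 0 < ε) (hw : IsWeight μ (returnWeight T (θ.cell ε))) :
    boxRetPFlog T μ θ ε = ∫ x, Real.log (returnWeight T (θ.cell ε) x).toReal ∂μ := by
  rw [θ.integral_eq_tsum hε hw.integrable_log, boxRetPFlog]
  refine tsum_congr fun j => ?_
  simp only [toReal_returnWeight]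
  rw [θ.setIntegral_box_cell hε j fun A x => Real.log (firstReturn T A x : ℝ)⁻¹]

variable [IsProbabilityMeasure μ]

theorem ae_firstReturn_cell_pos (hT : MeasurePreserving T μ μ) (hε : 0 < ε) :
    ∀ᵐ x ∂μ, 0 < firstReturn T (θ.cell ε x) x := by
  have := ae_all_iff.2 fun j => ae_firstReturn_pos hT (θ.measurableSet_box hε j)
  filter_upwards [this] with x hx
  exact hx _ ((θ.mem_box_iff hε).2 rfl)

theorem lintegral_returnWeight_cell_inv_le (hT : MeasurePreserving T μ μ) (hε : 0 < ε)
    (hS : ∀ j ∉ S, μ (θ.box ε j) = 0) :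
    ∫⁻ x, (returnWeight T (θ.cell ε) x)⁻¹ ∂μ ≤ S.card := by
  refine θ.lintegral_le_card hε hS fun j => ?_
  simp only [returnWeight, inv_inv]
  rw [θ.setLIntegral_box_cell hε j fun A x => (firstReturn T A x : ℝ≥0∞)]
  exact setLIntegral_firstReturn_le_one hT (θ.measurableSet_box hε j)

theorem isWeight_measureWeight_cell (hε : 0 < ε) (hS : ∀ j ∉ S, μ (θ.box ε j) = 0) :
    IsWeight μ (measureWeight μ (θ.cell ε)) :=
  ⟨(measurable_measureWeight (θ.measurableSet_cell hε)).aemeasurable,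
    .of_forall fun _ => prob_le_one,
    ne_top_of_le_ne_top (ENNReal.natCast_ne_top _) (θ.lintegral_measureWeight_cell_inv_le hε hS)⟩

theorem isWeight_returnWeight_cell (hT : MeasurePreserving T μ μ) (hε : 0 < ε)
    (hS : ∀ j ∉ S, μ (θ.box ε j) = 0) : IsWeight μ (returnWeight T (θ.cell ε)) :=
  ⟨(measurable_returnWeight hT.measurable (θ.measurableSet_cell hε)).aemeasurable,
    (θ.ae_firstReturn_cell_pos hT hε).mono fun _ => returnWeight_le_one,
    ne_top_of_le_ne_top (ENNReal.natCast_ne_top _)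
      (θ.lintegral_returnWeight_cell_inv_le hT hε hS)⟩

theorem isModerate_measureWeight_cell {X : Set (Euc n)} (hXc : IsCompact X) (hX : μ X = 1) :
    IsModerate μ fun ε => measureWeight μ (θ.cell ε) := by
  obtain ⟨m, hm⟩ := θ.exists_finset_box_null hXc hX
  refine ⟨m, ?_⟩
  filter_upwards [hm, self_mem_nhdsWithin] with ε ⟨S, hS, hc⟩ hε
  refine ⟨θ.isWeight_measureWeight_cell hε hS,
    (θ.lintegral_measureWeight_cell_inv_le hε hS).trans ?_⟩
  rw [← ENNReal.ofReal_natCast]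
  exact ENNReal.ofReal_le_ofReal hc

theorem isModerate_returnWeight_cell (hT : MeasurePreserving T μ μ) {X : Set (Euc n)}
    (hXc : IsCompact X) (hX : μ X = 1) : IsModerate μ fun ε => returnWeight T (θ.cell ε) := by
  obtain ⟨m, hm⟩ := θ.exists_finset_box_null hXc hX
  refine ⟨m, ?_⟩
  filter_upwards [hm, self_mem_nhdsWithin] with ε ⟨S, hS, hc⟩ hε
  refine ⟨θ.isWeight_returnWeight_cell hT hε hS,
    (θ.lintegral_returnWeight_cell_inv_le hT hε hS).trans ?_⟩
  rw [← ENNReal.ofReal_natCast]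
  exact ENNReal.ofReal_le_ofReal hc

end Grid

theorem IsModerate.of_le {α : Type*} [MeasurableSpace α] {μ : Measure α} {f g : ℝ → α → ℝ≥0∞}
    {c : ℝ} (hc : 0 < c) (hf : IsModerate μ f)
    (hg : ∀ᶠ ε in 𝓝[>] (0:ℝ), AEMeasurable (g ε) μ ∧ (∀ᵐ x ∂μ, g ε x ≤ 1) ∧
      ∀ᵐ x ∂μ, f (c * ε) x ≤ g ε x) : IsModerate μ g := by
  obtain ⟨m, hm⟩ := hf
  refine ⟨2 * m, ?_⟩
  have hm' : ∀ᶠ ε in 𝓝[>] (0:ℝ), IsWeight μ (f (c * ε)) ∧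
      ∫⁻ x, (f (c * ε) x)⁻¹ ∂μ ≤ ENNReal.ofReal ((c * ε)⁻¹ ^ m) :=
    (tendsto_const_mul_nhdsGT_zero hc).eventually hm
  filter_upwards [hm', hg, Ioo_mem_nhdsGT hc] with ε h1 ⟨h2, h3, h4⟩ hε
  refine ⟨h1.1.of_le h2 h3 h4, le_trans (lintegral_mono_ae ?_) (h1.2.trans ?_)⟩
  · filter_upwards [h4] with x hx
    exact ENNReal.inv_le_inv.2 hx
  · have hε0 : 0 < ε := hε.1
    refine ENNReal.ofReal_le_ofReal ?_
    rw [pow_mul]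
    refine pow_le_pow_left₀ (by positivity) ?_ m
    rw [inv_pow]
    refine inv_anti₀ (by positivity) ?_
    nlinarith [hε.2]

namespace Grid

variable (θ : Grid n) [IsProbabilityMeasure μ]

theorem returnWeight_cell_le_ball (hT : MeasurePreserving T μ μ) (hε : 0 < ε) :
    ∀ᵐ x ∂μ, returnWeight T (θ.cell ((n + 1 : ℝ)⁻¹ * ε)) x
      ≤ returnWeight T (fun x => Metric.ball x ε) x := by
  filter_upwards [θ.ae_firstReturn_cell_pos hT
    (show 0 < (n + 1 : ℝ)⁻¹ * ε by positivity)] with x hx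
  exact returnWeight_mono (θ.cell_subset_ball_mul hε x) hx

theorem isModerate_measureWeight_ball (θ : Grid n) {X : Set (Euc n)} (hXc : IsCompact X)
    (hX : μ X = 1) :
    IsModerate μ fun ε => measureWeight μ fun x => Metric.ball x ε := by
  refine (θ.isModerate_measureWeight_cell hXc hX).of_le (c := (n + 1 : ℝ)⁻¹) (by positivity) ?_
  filter_upwards [self_mem_nhdsWithin] with ε hε
  exact ⟨(measurable_measureWeight (measurableSet_mem_ball ε)).aemeasurable,
    .of_forall fun _ => prob_le_one, .of_forall fun x => θ.measureWeight_cell_le_ball hε x⟩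

theorem isModerate_returnWeight_ball (θ : Grid n) (hT : MeasurePreserving T μ μ) {X : Set (Euc n)}
    (hXc : IsCompact X) (hX : μ X = 1) :
    IsModerate μ fun ε => returnWeight T fun x => Metric.ball x ε := by
  refine (θ.isModerate_returnWeight_cell hT hXc hX).of_le (c := (n + 1 : ℝ)⁻¹) (by positivity) ?_
  filter_upwards [self_mem_nhdsWithin] with ε hε
  refine ⟨(measurable_returnWeight hT.measurable (measurableSet_mem_ball ε)).aemeasurable, ?_,
    θ.returnWeight_cell_le_ball hT hε⟩
  have hε0 : 0 < ε := hε
  filter_upwards [θ.ae_firstReturn_cell_pos hT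
    (show 0 < (n + 1 : ℝ)⁻¹ * ε by positivity)] with x hx
  exact returnWeight_le_one (firstReturn_pos hx
    (θ.cell_subset_ball_mul hε0 x (iterate_firstReturn_mem hx)))

/-- The partition function of the box masses as an integral of the cell weight. -/
theorem boxMeasPF_eq (hε : 0 < ε) (q : ℝ) :
    boxMeasPF μ θ ε q = ∫⁻ x, measureWeight μ (θ.cell ε) x ^ (q - 1) ∂μ := by
  rw [θ.lintegral_eq_tsum hε, boxMeasPF]
  refine tsum_congr fun j => ?_
  simp only [measureWeight]
  rw [θ.setLIntegral_box_cell hε j fun A _ => μ A ^ (q - 1), setLIntegral_const]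
  split_ifs with h
  · rw [h, mul_zero]
  · nth_rewrite 3 [← ENNReal.rpow_one (μ (θ.box ε j))]
    rw [← ENNReal.rpow_add _ _ h (measure_ne_top _ _), sub_add_cancel]

/-- Jensen's inequality combined with Kac's inequality, in integrated form. -/
theorem lintegral_measureWeight_mul_returnWeight_inv_le (hT : MeasurePreserving T μ μ)
    (hε : 0 < ε) {q : ℝ} (hq : 0 < q) :
    ∫⁻ x, measureWeight μ (θ.cell ε) x ^ q * (returnWeight T (θ.cell ε) x)⁻¹ ∂μ
      ≤ ∫⁻ x, measureWeight μ (θ.cell ε) x ^ (q - 1) ∂μ := by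
  rw [← θ.boxMeasPF_eq hε q, boxMeasPF, θ.lintegral_eq_tsum hε]
  refine ENNReal.tsum_le_tsum fun j => ?_
  simp only [measureWeight, returnWeight, inv_inv]
  rw [θ.setLIntegral_box_cell hε j fun A x => μ A ^ q * (firstReturn T A x : ℝ≥0∞)]
  split_ifs with h
  · rw [setLIntegral_measure_zero _ _ h]
  · rw [lintegral_const_mul' _ _ (ENNReal.rpow_ne_top_of_nonneg hq.le (measure_ne_top _ _))]
    exact mul_le_of_le_one_right' (setLIntegral_firstReturn_le_one hT (θ.measurableSet_box hε j))

theorem lintegral_ball_mul_cell_inv_le (hε : 0 < ε) {q : ℝ} (hq : 0 < q) :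
    ∫⁻ x, measureWeight μ (fun x => Metric.ball x ε) x ^ q * (measureWeight μ (θ.cell ε) x)⁻¹ ∂μ
      ≤ ((offsets n).card ^ q * (offsets n).card : ℝ≥0∞)
        * ∫⁻ x, measureWeight μ (θ.cell ε) x ^ (q - 1) ∂μ := by
  have hbox : ∫⁻ x, measureWeight μ (θ.cell ε) x ^ (q - 1) ∂μ = ∑' j, μ (θ.box ε j) ^ q := by
    rw [← θ.boxMeasPF_eq hε q, boxMeasPF]
    refine tsum_congr fun j => ?_
    split_ifs with h
    · rw [h, ENNReal.zero_rpow_of_pos hq]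
    · rfl
  have hball : ∀ j, ∀ x ∈ θ.box ε j,
      measureWeight μ (fun x => Metric.ball x ε) x ^ q * (measureWeight μ (θ.cell ε) x)⁻¹
        ≤ (∑ s ∈ offsets n, μ (θ.box ε (j + s))) ^ q * (μ (θ.box ε j))⁻¹ := by
    intro j x hx
    simp only [measureWeight, θ.cell_eq_box hε hx]
    gcongr
    exact (measure_mono (θ.ball_subset_biUnion_box hε hx)).trans (measure_biUnion_finset_le _ _)
  have hpow : ∀ t : (Fin n → ℤ) → ℝ≥0∞, (∑ s ∈ offsets n, t s) ^ q
      ≤ (offsets n).card ^ q * ∑ s ∈ offsets n, t s ^ q := by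
    intro t
    have h1 : ∑ s ∈ offsets n, t s
        ≤ (offsets n).card * (∑ s ∈ offsets n, t s ^ q) ^ q⁻¹ := by
      rw [← nsmul_eq_mul]
      refine Finset.sum_le_card_nsmul _ _ _ fun s hs => ?_
      rw [ENNReal.le_rpow_inv_iff hq]
      exact Finset.single_le_sum (f := fun s => t s ^ q) (fun _ _ => zero_le) hs
    calc _ ≤ _ := ENNReal.rpow_le_rpow h1 hq.le
      _ = _ := by rw [ENNReal.mul_rpow_of_nonneg _ _ hq.le, ENNReal.rpow_inv_rpow hq.ne']
  rw [hbox, θ.lintegral_eq_tsum hε]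
  calc ∑' j, ∫⁻ x in θ.box ε j, measureWeight μ (fun x => Metric.ball x ε) x ^ q
          * (measureWeight μ (θ.cell ε) x)⁻¹ ∂μ
      ≤ ∑' j, (∑ s ∈ offsets n, μ (θ.box ε (j + s))) ^ q := by
        refine ENNReal.tsum_le_tsum fun j => ?_
        refine (setLIntegral_mono' (θ.measurableSet_box hε j) (hball j)).trans ?_
        rw [setLIntegral_const, mul_assoc]
        exact mul_le_of_le_one_right' (ENNReal.inv_mul_le_one _)
    _ ≤ ∑' j, (offsets n).card ^ q * ∑ s ∈ offsets n, μ (θ.box ε (j + s)) ^ q :=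
        ENNReal.tsum_le_tsum fun j => hpow _
    _ = (offsets n).card ^ q * ∑ s ∈ offsets n, ∑' j, μ (θ.box ε (j + s)) ^ q := by
        rw [ENNReal.tsum_mul_left, Summable.tsum_finsetSum fun _ _ => ENNReal.summable]
    _ = (offsets n).card ^ q * ∑ s ∈ offsets n, ∑' j, μ (θ.box ε j) ^ q := by
        congr 1
        refine Finset.sum_congr rfl fun s _ => ?_
        exact (Equiv.addRight s).tsum_eq fun j => μ (θ.box ε j) ^ q
    _ = _ := by rw [Finset.sum_const, nsmul_eq_mul, mul_assoc]

end Grid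

end Weights

/-- For an ergodic dynamical system, for every grid `θ` and every `q > 0`,
the chain `D_τ^± ≤ Δ_τ^±(θ,q) ≤ Δ_μ^±(θ,q) = D_μ^±(q)` holds. -/
theorem dimension_chain_positive_q {n : ℕ} (T : Euc n → Euc n)
    (μ : Measure (Euc n)) [IsProbabilityMeasure μ] (X : Set (Euc n))
    (hXc : IsCompact X) (hX1 : μ X = 1) (hTX : Set.MapsTo T X X)
    (hErg : Ergodic T μ) :
    ∀ (θ : Grid n) (q : ℝ), 0 < q →
      (DtauPlus T μ q ≤ DeltaTauPlus T μ θ q ∧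
        DeltaTauPlus T μ θ q ≤ DeltaMuPlus μ θ q ∧
        DeltaMuPlus μ θ q = DmuPlus μ q) ∧
      (DtauMinus T μ q ≤ DeltaTauMinus T μ θ q ∧
        DeltaTauMinus T μ θ q ≤ DeltaMuMinus μ θ q ∧
        DeltaMuMinus μ θ q = DmuMinus μ q) := by
  intro θ q hq
  have hT : MeasurePreserving T μ μ := hErg.toMeasurePreserving
  have hpos : ∀ᶠ ε in 𝓝[>] (0:ℝ), 0 < ε := self_mem_nhdsWithin
  have hc : (0:ℝ) < (n + 1 : ℝ)⁻¹ := by positivity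
  have hmC := θ.isModerate_measureWeight_cell hXc hX1
  have hrC := θ.isModerate_returnWeight_cell hT hXc hX1
  have hmB := θ.isModerate_measureWeight_ball hXc hX1
  have hrB := θ.isModerate_returnWeight_ball hT hXc hX1
  have hmCw := hmC.eventually_isWeight
  have hrCw := hrC.eventually_isWeight
  have hmBw := hmB.eventually_isWeight
  have hrBw := hrB.eventually_isWeight
  have hmCF := hpos.mono fun ε hε => θ.boxMeasPF_eq (μ := μ) hε q
  have hrCF := hpos.mono fun ε hε => θ.boxRetPF_eq (μ := μ) (T := T) hε q
  have hmCl := (hpos.and hmCw).mono fun ε hε => θ.boxMeasPFlog_eq hε.1 hε.2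
  have hrCl := (hpos.and hrCw).mono fun ε hε => θ.boxRetPFlog_eq hε.1 hε.2
  have hmBF : ∀ᶠ ε in 𝓝[>] (0:ℝ), measPF μ ε q
      = ∫⁻ x, measureWeight μ (fun x => Metric.ball x ε) x ^ (q - 1) ∂μ :=
    .of_forall fun _ => rfl
  have hmBl : ∀ᶠ ε in 𝓝[>] (0:ℝ), measPFlog μ ε
      = ∫ x, Real.log (measureWeight μ (fun x => Metric.ball x ε) x).toReal ∂μ :=
    .of_forall fun _ => rfl
  have hrBF : ∀ᶠ ε in 𝓝[>] (0:ℝ), retPF T μ ε q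
      = ∫⁻ x, returnWeight T (fun x => Metric.ball x ε) x ^ (q - 1) ∂μ :=
    .of_forall fun _ => by simp only [returnWeight_rpow, retPF]
  have hrBl : ∀ᶠ ε in 𝓝[>] (0:ℝ), retPFlog T μ ε
      = ∫ x, Real.log (returnWeight T (fun x => Metric.ball x ε) x).toReal ∂μ :=
    .of_forall fun _ => by simp only [toReal_returnWeight, retPFlog]
  have hDτΔτ : ∀ᶠ ε in 𝓝[>] (0:ℝ),
      logPowerMean μ q (returnWeight T (θ.cell ((n + 1 : ℝ)⁻¹ * ε)))
        ≤ logPowerMean μ q (returnWeight T fun x => Metric.ball x ε) + 0 := by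
    filter_upwards [hpos, (tendsto_const_mul_nhdsGT_zero hc).eventually hrCw, hrBw]
      with ε hε h1 h2
    rw [add_zero]
    exact h1.logPowerMean_mono h2 hq (θ.returnWeight_cell_le_ball hT hε)
  have hDμΔμ : ∀ᶠ ε in 𝓝[>] (0:ℝ),
      logPowerMean μ q (measureWeight μ (θ.cell ((n + 1 : ℝ)⁻¹ * ε)))
        ≤ logPowerMean μ q (measureWeight μ fun x => Metric.ball x ε) + 0 := by
    filter_upwards [hpos, (tendsto_const_mul_nhdsGT_zero hc).eventually hmCw, hmBw]
      with ε hε h1 h2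
    rw [add_zero]
    exact h1.logPowerMean_mono h2 hq (.of_forall (θ.measureWeight_cell_le_ball hε))
  have hΔτΔμ : ∀ᶠ ε in 𝓝[>] (0:ℝ), logPowerMean μ q (measureWeight μ (θ.cell (1 * ε)))
      ≤ logPowerMean μ q (returnWeight T (θ.cell ε)) + 0 := by
    filter_upwards [hpos, hmCw, hrCw] with ε hε h1 h2
    rw [add_zero, one_mul]
    exact h2.logPowerMean_le_of_lintegral_le h1 hq
      (θ.lintegral_measureWeight_mul_returnWeight_inv_le hT hε hq)
  have hΔμDμ : ∀ᶠ ε in 𝓝[>] (0:ℝ),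
      logPowerMean μ q (measureWeight μ fun x => Metric.ball x (1 * ε))
        ≤ logPowerMean μ q (measureWeight μ (θ.cell ε))
          + Real.log ((Grid.offsets n).card ^ q * (Grid.offsets n).card : ℝ≥0∞).toReal / q := by
    filter_upwards [hpos, hmCw, hmBw] with ε hε h1 h2
    rw [one_mul]
    exact h1.logPowerMean_le_of_lintegral_le_mul h2 hq
      (ENNReal.mul_ne_top (ENNReal.rpow_ne_top_of_nonneg hq.le (ENNReal.natCast_ne_top _))
        (ENNReal.natCast_ne_top _)) (θ.lintegral_ball_mul_cell_inv_le hε hq)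
  obtain ⟨MmC, hMmC⟩ := hmC.abs_div_log_le hq
  obtain ⟨MrC, hMrC⟩ := hrC.abs_div_log_le hq
  obtain ⟨MmB, hMmB⟩ := hmB.abs_div_log_le hq
  refine ⟨?_, ?_⟩
  · rw [DtauPlus, DeltaTauPlus, DeltaMuPlus, DmuPlus, hrB.dimPlus_eq hq hrBF hrBl,
      hrC.dimPlus_eq hq hrCF hrCl, hmC.dimPlus_eq hq hmCF hmCl, hmB.dimPlus_eq hq hmBF hmBl]
    exact ⟨limsup_logRate_le hc hMrC hDτΔτ, limsup_logRate_le one_pos hMmC hΔτΔμ,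
      le_antisymm (limsup_logRate_le one_pos hMmB hΔμDμ) (limsup_logRate_le hc hMmC hDμΔμ)⟩
  · rw [DtauMinus, DeltaTauMinus, DeltaMuMinus, DmuMinus, hrB.dimMinus_eq hq hrBF hrBl,
      hrC.dimMinus_eq hq hrCF hrCl, hmC.dimMinus_eq hq hmCF hmCl, hmB.dimMinus_eq hq hmBF hmBl]
    exact ⟨liminf_logRate_le hc hMrC hDτΔτ, liminf_logRate_le one_pos hMmC hΔτΔμ,
      le_antisymm (liminf_logRate_le one_pos hMmB hΔμDμ) (liminf_logRate_le hc hMmC hDμΔμ)⟩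
end

section
/- Let ρ(ε;m) = μ({x ∈ X : τ_{B_ε(x)}(x) = m}) and R(ε;k) = Σ_{m=1}^k ρ(ε;m). If for some integer k ≥ 1 there exist constants C > 0 and δ > 0 such that R(ε;k) ≥ C·ε^δ for all sufficiently small ε > 0, then D_τ^+(q) ≤ δ/(q-1) and D_τ^-(q) ≤ δ/(q-1) for all q > 1. -/
open MeasureTheory Filter Set
open scoped ENNReal Topology NNReal

/-- `R(ε;k) = Σ_{m=1}^k ρ(ε;m)`, where `ρ(ε;m) = μ({x : τ_{B_ε(x)}(x) = m})` is the
distribution of the first return of a point into the ball of radius `ε` centered at it. -/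
noncomputable def shortReturnDist {α : Type*} [MeasurableSpace α] [PseudoMetricSpace α]
    (T : α → α) (μ : MeasureTheory.Measure α) (ε : ℝ) (k : ℕ) : ℝ≥0∞ :=
  ∑ m ∈ Finset.Icc 1 k, μ {x | firstReturn T (Metric.ball x ε) x = m}

theorem firstReturn_eq_iff {α : Type*} (T : α → α) (A : Set α) (x : α) {m : ℕ} (hm : 1 ≤ m) :
    firstReturn T A x = m ↔ T^[m] x ∈ A ∧ ∀ j < m, 0 < j → T^[j] x ∉ A := by
  unfold firstReturn
  constructor
  · rintro rfl
    refine ⟨(Nat.sInf_mem (Nat.nonempty_of_pos_sInf hm)).2, fun j hj h0 hA => ?_⟩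
    exact Nat.notMem_of_lt_sInf hj ⟨h0, hA⟩
  · rintro ⟨hA, h⟩
    refine le_antisymm (Nat.sInf_le ⟨hm, hA⟩) ?_
    refine le_csInf ⟨m, hm, hA⟩ fun j hj => ?_
    by_contra! hlt
    exact h j hlt hj.1 hj.2

theorem measurableSet_firstReturn_ball_eq {α : Type*} [MeasurableSpace α] [PseudoMetricSpace α]
    [OpensMeasurableSpace α] [SecondCountableTopology α] {T : α → α} (hT : Measurable T)
    (ε : ℝ) {m : ℕ} (hm : 1 ≤ m) :
    MeasurableSet {x | firstReturn T (Metric.ball x ε) x = m} := by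
  have hball (j : ℕ) : MeasurableSet {x | T^[j] x ∈ Metric.ball x ε} :=
    measurableSet_lt ((hT.iterate j).dist measurable_id) measurable_const
  simp only [firstReturn_eq_iff T _ _ hm, ofPred_and, ofPred_forall]
  exact (hball m).inter (.iInter fun j => .iInter fun _ => .iInter fun _ => (hball j).compl)

theorem shortReturnDist_mul_le_retPF {α : Type*} [MeasurableSpace α] [PseudoMetricSpace α]
    [OpensMeasurableSpace α] [SecondCountableTopology α] {T : α → α} (hT : Measurable T)
    (μ : Measure α) (ε : ℝ) (k : ℕ) {q : ℝ} (hq : 1 ≤ q) :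
    (k : ℝ≥0∞) ^ (1 - q) * shortReturnDist T μ ε k ≤ retPF T μ ε q := by
  set S : ℕ → Set α := fun m => {x | firstReturn T (Metric.ball x ε) x = m}
  have hmeas : ∀ m ∈ Finset.Icc 1 k, MeasurableSet (S m) := fun m hm =>
    measurableSet_firstReturn_ball_eq hT ε (Finset.mem_Icc.1 hm).1
  have hsum : shortReturnDist T μ ε k = μ (⋃ m ∈ Finset.Icc 1 k, S m) := by
    refine (measure_biUnion_finset (fun a _ b _ hab => ?_) hmeas).symm
    exact Set.disjoint_left.2 fun x hxa hxb => hab (hxa.symm.trans hxb)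
  rw [hsum, ← lintegral_indicator_const (Finset.measurableSet_biUnion _ hmeas)]
  refine lintegral_mono (indicator_le fun x hx => ?_)
  obtain ⟨m, hm, hxm⟩ := mem_iUnion₂.1 hx
  rw [show firstReturn T (Metric.ball x ε) x = m from hxm]
  rw [← neg_sub q 1, ENNReal.rpow_neg, ENNReal.rpow_neg, ENNReal.inv_le_inv]
  exact ENNReal.rpow_le_rpow (by exact_mod_cast (Finset.mem_Icc.1 hm).2) (sub_nonneg.2 hq)

theorem dimScale_le_of_ofReal_le {F : ℝ → ℝ≥0∞} {q ε c δ : ℝ} (hq : 1 < q) (hε : 0 < ε)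
    (hε1 : ε < 1) (hc : 0 < c) (h : ENNReal.ofReal (c * ε ^ δ) ≤ F ε) :
    dimScale F q ε ≤ ((Real.log c / ((q - 1) * Real.log ε) + δ / (q - 1) : ℝ) : EReal) := by
  have hlog : Real.log ε < 0 := Real.log_neg hε hε1
  have hq0 : 0 < q - 1 := sub_pos.2 hq
  have hcoef : ((q - 1) * Real.log ε)⁻¹ < 0 := inv_lt_zero.2 (mul_neg_of_pos_of_neg hq0 hlog)
  have hpow : 0 < c * ε ^ δ := mul_pos hc (Real.rpow_pos_of_pos hε δ)
  have hF0 : F ε ≠ 0 := ((ENNReal.ofReal_pos.2 hpow).trans_le h).ne'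
  unfold dimScale elog
  rw [if_neg hF0]
  split_ifs with hF
  · rw [EReal.coe_mul_top_of_neg hcoef]
    exact bot_le
  · rw [← EReal.coe_mul, EReal.coe_le_coe_iff]
    have hle : Real.log c + δ * Real.log ε ≤ Real.log (F ε).toReal := by
      rw [← Real.log_rpow hε, ← Real.log_mul hc.ne' (Real.rpow_pos_of_pos hε δ).ne']
      exact Real.log_le_log hpow ((ENNReal.ofReal_le_iff_le_toReal hF).1 h)
    refine (mul_le_mul_of_nonpos_left hle hcoef.le).trans_eq ?_
    have := hlog.ne
    have := hq0.ne'
    field_simp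

theorem limsup_dimScale_le {F : ℝ → ℝ≥0∞} {q c δ : ℝ} (hq : 1 < q) (hc : 0 < c)
    (h : ∀ᶠ ε in 𝓝[>] (0:ℝ), ENNReal.ofReal (c * ε ^ δ) ≤ F ε) :
    limsup (dimScale F q) (𝓝[>] (0:ℝ)) ≤ ((δ / (q - 1) : ℝ) : EReal) := by
  have hlim : Tendsto (fun ε => Real.log c / ((q - 1) * Real.log ε) + δ / (q - 1))
      (𝓝[>] (0:ℝ)) (𝓝 (δ / (q - 1))) := by
    have hden := Real.tendsto_log_nhdsGT_zero.const_mul_atBot (sub_pos.2 hq)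
    simpa using (hden.const_div_atBot (Real.log c)).add_const (δ / (q - 1))
  rw [← ((continuous_coe_real_ereal.tendsto _).comp hlim).limsup_eq]
  refine limsup_le_limsup ?_
  filter_upwards [h, Ioo_mem_nhdsGT one_pos] with ε hε hmem
  exact dimScale_le_of_ofReal_le hq hmem.1 hmem.2 hc hε

/-- If for some `k ≥ 1` there are `C > 0`, `δ > 0` with
`R(ε;k) ≥ C ε^δ` for all sufficiently small `ε > 0`, then `D_τ^±(q) ≤ δ/(q-1)` for all
`q > 1`. -/
theorem short_returns_bound_dimensions {n : ℕ} (T : Euc n → Euc n)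
    (μ : Measure (Euc n)) [IsProbabilityMeasure μ] (X : Set (Euc n))
    (hXc : IsCompact X) (hX1 : μ X = 1) (hTX : Set.MapsTo T X X)
    (hErg : Ergodic T μ) (k : ℕ) (hk : 1 ≤ k) (C δ : ℝ) (hC : 0 < C) (hδ : 0 < δ)
    (hR : ∀ᶠ ε in 𝓝[>] (0:ℝ),
      ENNReal.ofReal (C * ε ^ δ) ≤ shortReturnDist T μ ε k) :
    ∀ q : ℝ, 1 < q →
      DtauPlus T μ q ≤ ((δ / (q - 1) : ℝ) : EReal) ∧
        DtauMinus T μ q ≤ ((δ / (q - 1) : ℝ) : EReal) := by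
  intro q hq
  have hk0 : (0 : ℝ) < k := by exact_mod_cast hk
  have hF : ∀ᶠ ε in 𝓝[>] (0:ℝ),
      ENNReal.ofReal ((k : ℝ) ^ (1 - q) * C * ε ^ δ) ≤ retPF T μ ε q := by
    filter_upwards [hR] with ε hε
    refine le_trans ?_ (shortReturnDist_mul_le_retPF hErg.measurable μ ε k hq.le)
    rw [mul_assoc, ENNReal.ofReal_mul (Real.rpow_nonneg hk0.le _),
      ← ENNReal.ofReal_rpow_of_pos hk0, ENNReal.ofReal_natCast]
    gcongr
  have hsup : limsup (dimScale (fun ε => retPF T μ ε q) q) (𝓝[>] (0:ℝ)) ≤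
      ((δ / (q - 1) : ℝ) : EReal) :=
    limsup_dimScale_le hq (mul_pos (Real.rpow_pos_of_pos hk0 _) hC) hF
  rw [DtauPlus, DtauMinus, dimPlus, dimMinus, if_neg hq.ne', if_neg hq.ne']
  exact ⟨hsup, le_trans liminf_le_limsup hsup⟩
end

section
/- Lebesgue measure λ on [0,1] is invariant and ergodic for the von Neumann–Kakutani map T; moreover the dynamical system ([0,1], T, λ) is topologically transitive but not strongly mixing. -/
open MeasureTheory Filter Set
open scoped Topology

theorem exists_dyadic_near {y : ℝ} (hy : y ∈ Icc (0 : ℝ) 1) (n : ℕ) :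
    ∃ j : ℕ, j < 2 ^ n ∧ j * (1 / 2 : ℝ) ^ n ≤ y ∧ y ≤ (j + 1) * (1 / 2) ^ n := by
  have h2 : (2 : ℝ) ^ n * (1 / 2) ^ n = 1 := by rw [← mul_pow]; norm_num
  have hpos : (0 : ℝ) < (1 / 2) ^ n := by positivity
  rcases hy.2.lt_or_eq with hlt | rfl
  · refine ⟨⌊y * 2 ^ n⌋₊, ?_, ?_, ?_⟩
    · rw [Nat.floor_lt (by have := hy.1; positivity)]
      push_cast
      nlinarith [show (0 : ℝ) < 2 ^ n by positivity]
    · have := Nat.floor_le (a := y * 2 ^ n) (by have := hy.1; positivity)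
      nlinarith
    · have := Nat.lt_floor_add_one (y * 2 ^ n)
      nlinarith
  · have h1 : 1 ≤ 2 ^ n := Nat.one_le_two_pow
    refine ⟨2 ^ n - 1, by omega, ?_, ?_⟩
    · push_cast [h1]
      nlinarith
    · push_cast [h1]
      nlinarith

theorem eq_mul_of_monotone_of_dyadic {F : ℝ → ℝ} (hF : Monotone F)
    (h : ∀ n j : ℕ, j ≤ 2 ^ n → F (j * (1 / 2) ^ n) = F 1 * (j * (1 / 2) ^ n))
    {t : ℝ} (ht : t ∈ Icc (0 : ℝ) 1) : F t = F 1 * t := by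
  have h0 : F 0 = 0 := by simpa using h 0 0 (by simp)
  have hc : 0 ≤ F 1 := h0 ▸ hF zero_le_one
  have key : ∀ n : ℕ, |F t - F 1 * t| ≤ F 1 * (1 / 2) ^ n := by
    intro n
    obtain ⟨j, hj, h1, h2⟩ := exists_dyadic_near ht n
    have e1 := h n j hj.le
    have e2 := h n (j + 1) hj
    push_cast at e2
    have m1 := hF h1
    have m2 := hF h2
    have c1 := mul_le_mul_of_nonneg_left h1 hc
    have c2 := mul_le_mul_of_nonneg_left h2 hc
    rw [abs_le]
    constructor <;> nlinarith
  have hlim : Tendsto (fun n : ℕ => F 1 * (1 / 2 : ℝ) ^ n) atTop (𝓝 0) := by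
    simpa using (tendsto_pow_atTop_nhds_zero_of_lt_one (r := (1 / 2 : ℝ)) (by norm_num)
      (by norm_num)).const_mul (F 1)
  have := abs_nonpos_iff.1 (ge_of_tendsto' hlim key)
  linarith

/-- A finite measure on `[0,1)` giving equal mass to all dyadic intervals of the same order is a
multiple of Lebesgue measure. -/
theorem measure_eq_smul_restrict_Ico_of_dyadic (ν : Measure ℝ) [IsFiniteMeasure ν]
    (h0 : ν (Iio 0) = 0) (h1 : ν (Ici 1) = 0)
    (h : ∀ n j : ℕ, j < 2 ^ n → ν (Ico (j * (1 / 2) ^ n) ((j + 1) * (1 / 2) ^ n)) =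
      ν (Ico 0 ((1 / 2) ^ n))) :
    ν = ν univ • volume.restrict (Ico (0 : ℝ) 1) := by
  set F : ℝ → ℝ := fun t => ν.real (Iio t) with hF
  have hmono : Monotone F := fun a b hab => measureReal_mono (Iio_subset_Iio hab)
  have hF0 : F 0 = 0 := by simp [hF, measureReal_def, h0]
  have hadd : ∀ a b : ℝ, a ≤ b → F b = F a + ν.real (Ico a b) := by
    intro a b hab
    rw [hF]
    dsimp only
    rw [← measureReal_union _ measurableSet_Ico, Iio_union_Ico_eq_Iio hab]
    exact Set.disjoint_left.2 fun x hx hx' => not_lt.2 hx'.1 hx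
  have hstep : ∀ n j : ℕ, j ≤ 2 ^ n → F (j * (1 / 2) ^ n) = j * F ((1 / 2) ^ n) := by
    intro n j
    have hpos : (0 : ℝ) < (1 / 2) ^ n := by positivity
    induction j with
    | zero => intro _; simpa using hF0
    | succ j ih =>
      intro hj
      have e1 := hadd (j * (1 / 2) ^ n) ((j + 1) * (1 / 2) ^ n) (by nlinarith)
      have e2 := hadd 0 ((1 / 2) ^ n) hpos.le
      rw [measureReal_def, h n j hj, ← measureReal_def, ih (by omega)] at e1
      push_cast
      linarith
  have hdy : ∀ n j : ℕ, j ≤ 2 ^ n → F (j * (1 / 2) ^ n) = F 1 * (j * (1 / 2) ^ n) := by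
    intro n j hj
    have e := hstep n (2 ^ n) le_rfl
    have h2 : (2 : ℝ) ^ n * (1 / 2) ^ n = 1 := by rw [← mul_pow]; norm_num
    push_cast at e
    rw [h2] at e
    rw [hstep n j hj, e]
    linear_combination (-(j : ℝ) * F ((1 / 2) ^ n)) * h2
  have huniv : ν univ = ν (Iio 1) := by
    refine le_antisymm ?_ (measure_mono (subset_univ _))
    rw [← Iio_union_Ici (a := (1 : ℝ))]
    refine (measure_union_le _ _).trans ?_
    rw [h1, add_zero]
  refine ext_of_generate_finite _ (borel_eq_generateFrom_Iio ℝ ▸ BorelSpace.measurable_eq)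
    isPiSystem_Iio ?_ (by simp)
  rintro _ ⟨t, rfl⟩
  rw [Measure.smul_apply, Measure.restrict_apply measurableSet_Iio, smul_eq_mul]
  rcases lt_or_ge t 0 with ht | ht
  · have e : Iio t ∩ Ico (0 : ℝ) 1 = ∅ := by
      ext x
      simp only [mem_inter_iff, mem_Iio, mem_Ico, mem_empty_iff_false, iff_false]
      intro hx
      linarith [hx.1, hx.2.1]
    rw [e, measure_empty, mul_zero]
    exact measure_mono_null (Iio_subset_Iio ht.le) h0
  rcases le_or_gt t 1 with ht1 | ht1
  · have e : Iio t ∩ Ico (0 : ℝ) 1 = Ico 0 t := by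
      ext x
      simp only [mem_inter_iff, mem_Iio, mem_Ico]
      constructor
      · rintro ⟨a, b, c⟩; exact ⟨b, a⟩
      · rintro ⟨a, b⟩; exact ⟨b, a, by linarith⟩
    rw [e, Real.volume_Ico, sub_zero, huniv, ← ofReal_measureReal (μ := ν) (s := Iio t),
      ← ofReal_measureReal (μ := ν) (s := Iio 1), ← ENNReal.ofReal_mul measureReal_nonneg]
    congr 1
    exact eq_mul_of_monotone_of_dyadic hmono hdy ⟨ht, ht1⟩
  · have e : Iio t ∩ Ico (0 : ℝ) 1 = Ico 0 1 :=
      inter_eq_right.2 fun x hx => lt_trans hx.2 ht1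
    rw [e, Real.volume_Ico, sub_zero, ENNReal.ofReal_one, mul_one]
    refine le_antisymm (measure_mono (subset_univ _)) ?_
    rw [huniv]
    exact measure_mono (Iio_subset_Iio ht1.le)

/-- The defining formula of the von Neumann–Kakutani map on `[0,1)`, in terms of the distance of
the argument to `1`. -/
def IsVonNeumannKakutani (T : ℝ → ℝ) : Prop :=
  ∀ (k : ℕ) (x : ℝ), (1 / 2) ^ (k + 1) < 1 - x → 1 - x ≤ (1 / 2) ^ k →
    T x = x - 1 + (1 / 2) ^ k + (1 / 2) ^ (k + 1)

namespace IsVonNeumannKakutani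

variable {T : ℝ → ℝ}

theorem exists_pow_near {x : ℝ} (hx : x ∈ Ico (0 : ℝ) 1) :
    ∃ k : ℕ, (1 / 2 : ℝ) ^ (k + 1) < 1 - x ∧ 1 - x ≤ (1 / 2) ^ k :=
  exists_nat_pow_near_of_lt_one (by linarith [hx.2]) (by linarith [hx.1]) (by norm_num)
    (by norm_num)

theorem mapsTo_Ico (h : IsVonNeumannKakutani T) : MapsTo T (Ico 0 1) (Ico 0 1) := by
  intro x hx
  obtain ⟨k, h1, h2⟩ := exists_pow_near hx
  rw [h k x h1 h2]
  have hk : (1 / 2 : ℝ) ^ k ≤ 1 := pow_le_one₀ (by norm_num) (by norm_num)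
  have hpos : (0 : ℝ) < (1 / 2) ^ (k + 1) := by positivity
  constructor <;> linarith

theorem apply_of_lt_half (h : IsVonNeumannKakutani T) {x : ℝ} (hx : x ∈ Ico (0 : ℝ) (1 / 2)) :
    T x = x + 1 / 2 := by
  rw [h 0 x (by linarith [hx.2]) (by linarith [hx.1])]
  ring

theorem apply_add_half (h : IsVonNeumannKakutani T) {x : ℝ} (hx : x ∈ Ico (0 : ℝ) (1 / 2)) :
    T (x + 1 / 2) = T (2 * x) / 2 := by
  obtain ⟨k, h1, h2⟩ := exists_pow_near (x := 2 * x) ⟨by linarith [hx.1], by linarith [hx.2]⟩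
  rw [h k _ h1 h2, h (k + 1) (x + 1 / 2) (by rw [pow_succ]; linarith) (by rw [pow_succ]; linarith)]
  ring

theorem iterate_two_mul (h : IsVonNeumannKakutani T) (m : ℕ) {x : ℝ}
    (hx : x ∈ Ico (0 : ℝ) (1 / 2)) : T^[2 * m] x = T^[m] (2 * x) / 2 := by
  induction m generalizing x with
  | zero => simp
  | succ m ih =>
    have hT : T (T x) = T (2 * x) / 2 := by rw [h.apply_of_lt_half hx, h.apply_add_half hx]
    have h2 := h.mapsTo_Ico (x := 2 * x) ⟨by linarith [hx.1], by linarith [hx.2]⟩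
    rw [show 2 * (m + 1) = 2 * m + 1 + 1 by ring, Function.iterate_succ_apply,
      Function.iterate_succ_apply, hT, ih ⟨by linarith [h2.1], by linarith [h2.2]⟩,
      Function.iterate_succ_apply]
    congr 2
    ring

theorem mapsTo_iterate_two_mul (h : IsVonNeumannKakutani T) (m : ℕ) :
    MapsTo T^[2 * m] (Ico 0 (1 / 2)) (Ico 0 (1 / 2)) := by
  intro x hx
  rw [h.iterate_two_mul m hx]
  have := h.mapsTo_Ico.iterate m (x := 2 * x) ⟨by linarith [hx.1], by linarith [hx.2]⟩
  exact ⟨by linarith [this.1], by linarith [this.2]⟩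

theorem mapsTo_iterate_two_pow (h : IsVonNeumannKakutani T) (n : ℕ) :
    MapsTo T^[2 ^ n] (Ico 0 ((1 / 2) ^ n)) (Ico 0 ((1 / 2) ^ n)) := by
  induction n with
  | zero => simpa using h.mapsTo_Ico
  | succ n ih =>
    intro x hx
    have hn : (1 / 2 : ℝ) ^ n ≤ 1 := pow_le_one₀ (by norm_num) (by norm_num)
    rw [pow_succ] at hx ⊢
    rw [pow_succ', h.iterate_two_mul _ ⟨hx.1, by linarith [hx.2]⟩]
    have := ih (x := 2 * x) ⟨by linarith [hx.1], by linarith [hx.2]⟩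
    exact ⟨by linarith [this.1], by linarith [this.2]⟩

/-- Some iterate of `T` translates the leftmost dyadic interval of order `n` onto the `j`-th one. -/
theorem exists_iterate_eq_add (h : IsVonNeumannKakutani T) (n j : ℕ) (hj : j < 2 ^ n) :
    ∃ m : ℕ, ∀ x ∈ Ico (0 : ℝ) ((1 / 2) ^ n), T^[m] x = x + j * (1 / 2) ^ n := by
  induction n generalizing j with
  | zero =>
    obtain rfl : j = 0 := by simpa using hj
    exact ⟨0, by simp⟩
  | succ n ih =>
    have hn : (1 / 2 : ℝ) ^ n ≤ 1 := pow_le_one₀ (by norm_num) (by norm_num)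
    have main : ∀ i : ℕ, i < 2 ^ n → ∃ m : ℕ, ∀ x ∈ Ico (0 : ℝ) ((1 / 2) ^ (n + 1)),
        T^[2 * m] x = x + i * (1 / 2) ^ (n + 1) ∧ x ∈ Ico (0 : ℝ) (1 / 2) := by
      intro i hi
      obtain ⟨m, hm⟩ := ih i hi
      refine ⟨m, fun x hx => ?_⟩
      rw [pow_succ] at hx ⊢
      have hx' : x ∈ Ico (0 : ℝ) (1 / 2) := ⟨hx.1, by linarith [hx.2]⟩
      refine ⟨?_, hx'⟩
      rw [h.iterate_two_mul _ hx', hm _ ⟨by linarith [hx.1], by linarith [hx.2]⟩]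
      ring
    rcases lt_or_ge j (2 ^ n) with hlt | hge
    · obtain ⟨m, hm⟩ := main j hlt
      exact ⟨2 * m, fun x hx => (hm x hx).1⟩
    · obtain ⟨i, rfl⟩ := Nat.exists_eq_add_of_le hge
      obtain ⟨m, hm⟩ := main i (by rw [pow_succ] at hj; omega)
      refine ⟨2 * m + 1, fun x hx => ?_⟩
      obtain ⟨h1, h2⟩ := hm x hx
      rw [Function.iterate_succ_apply', h.apply_of_lt_half (h.mapsTo_iterate_two_mul m h2), h1]
      have : (2 : ℝ) ^ n * (1 / 2) ^ (n + 1) = 1 / 2 := by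
        rw [pow_succ, ← mul_assoc, ← mul_pow]; norm_num
      push_cast
      linear_combination -this

theorem exists_iterate_mem (h : IsVonNeumannKakutani T) {U V : Set ℝ} (hU : IsOpen U)
    (hV : IsOpen V) (hU' : (U ∩ Icc (0 : ℝ) 1).Nonempty) (hV' : (V ∩ Icc (0 : ℝ) 1).Nonempty) :
    ∃ m : ℕ, (T^[m] '' (U ∩ Icc (0 : ℝ) 1) ∩ V).Nonempty := by
  obtain ⟨u, hu, hu1⟩ := hU'
  obtain ⟨v, hv, hv1⟩ := hV'
  obtain ⟨ε, hε, hεU⟩ := Metric.isOpen_iff.1 hU u hu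
  obtain ⟨η, hη, hηV⟩ := Metric.isOpen_iff.1 hV v hv
  obtain ⟨n, hn⟩ := exists_pow_lt_of_lt_one (lt_min hε hη) (y := (1 / 2 : ℝ)) (by norm_num)
  obtain ⟨hnε, hnη⟩ := lt_min_iff.1 hn
  have hpos : (0 : ℝ) < (1 / 2) ^ n := by positivity
  obtain ⟨i, hi, hi1, hi2⟩ := exists_dyadic_near hu1 n
  obtain ⟨j, hj, hj1, hj2⟩ := exists_dyadic_near hv1 n
  obtain ⟨p, hp⟩ := h.exists_iterate_eq_add n i hi
  obtain ⟨q, hq⟩ := h.exists_iterate_eq_add n j hj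
  have h0 : (0 : ℝ) ∈ Ico (0 : ℝ) ((1 / 2) ^ n) := ⟨le_rfl, hpos⟩
  have hx : T^[p] 0 = i * (1 / 2) ^ n := by rw [hp 0 h0, zero_add]
  have hz := (h.mapsTo_iterate_two_pow n).iterate p h0
  rw [← Function.iterate_mul] at hz
  have hple : p ≤ 2 ^ n * p := Nat.le_mul_of_pos_left p (by positivity)
  refine ⟨q + (2 ^ n * p - p), T^[q] (T^[2 ^ n * p] 0), ⟨T^[p] 0, ⟨hεU ?_, ?_⟩, ?_⟩, hηV ?_⟩
  · rw [hx, Metric.mem_ball, Real.dist_eq, abs_lt]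
    constructor <;> linarith
  · rw [hx]
    exact ⟨by positivity, hi1.trans hu1.2⟩
  · rw [Function.iterate_add_apply, ← Function.iterate_add_apply T (2 ^ n * p - p) p,
      Nat.sub_add_cancel hple]
  · rw [hq _ hz, Metric.mem_ball, Real.dist_eq, abs_lt]
    constructor <;> linarith [hz.1, hz.2]

theorem measurePreserving (h : IsVonNeumannKakutani T) (hT : Measurable T) :
    MeasurePreserving T (volume.restrict (Ico (0 : ℝ) 1)) (volume.restrict (Ico (0 : ℝ) 1)) := by
  have hanti : Antitone fun k : ℕ => (1 / 2 : ℝ) ^ k :=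
    pow_right_anti₀ (by norm_num) (by norm_num)
  have hmono : Monotone fun k : ℕ => 1 - (1 / 2 : ℝ) ^ k := fun a b hab =>
    sub_le_sub_left (hanti hab) 1
  have hle : ∀ k : ℕ, (1 / 2 : ℝ) ^ k ≤ 1 := fun k => pow_le_one₀ (by norm_num) (by norm_num)
  have hdom : (⋃ k : ℕ, Ico (1 - (1 / 2 : ℝ) ^ k) (1 - (1 / 2) ^ (k + 1))) = Ico 0 1 := by
    ext x
    simp only [mem_iUnion]
    constructor
    · rintro ⟨k, h1, h2⟩
      have : (0 : ℝ) < (1 / 2) ^ (k + 1) := by positivity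
      exact ⟨by linarith [hle k], by linarith⟩
    · intro hx
      obtain ⟨k, h1, h2⟩ := exists_pow_near hx
      exact ⟨k, by linarith, by linarith⟩
  have hran : (⋃ k : ℕ, Ico ((1 / 2 : ℝ) ^ (k + 1)) ((1 / 2) ^ k)) =ᵐ[volume] Ico (0 : ℝ) 1 := by
    have e : (⋃ k : ℕ, Ioc ((1 / 2 : ℝ) ^ (k + 1)) ((1 / 2) ^ k)) = Ioc 0 1 := by
      ext x
      simp only [mem_iUnion]
      constructor
      · rintro ⟨k, h1, h2⟩
        exact ⟨lt_trans (by positivity) h1, h2.trans (hle k)⟩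
      · exact fun hx => exists_nat_pow_near_of_lt_one hx.1 hx.2 (by norm_num) (by norm_num)
    exact (Filter.EventuallyEq.countable_iUnion fun _ => Ico_ae_eq_Ioc).trans
      (e ▸ Ico_ae_eq_Ioc.symm)
  have hpiece : ∀ k : ℕ,
      (volume.restrict (Ico (1 - (1 / 2 : ℝ) ^ k) (1 - (1 / 2) ^ (k + 1)))).map T =
        volume.restrict (Ico ((1 / 2 : ℝ) ^ (k + 1)) ((1 / 2) ^ k)) := by
    intro k
    set c : ℝ := -1 + (1 / 2) ^ k + (1 / 2) ^ (k + 1) with hc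
    have hpre : (fun x : ℝ => x + c) ⁻¹' Ico ((1 / 2 : ℝ) ^ (k + 1)) ((1 / 2) ^ k) =
        Ico (1 - (1 / 2 : ℝ) ^ k) (1 - (1 / 2) ^ (k + 1)) := by
      rw [preimage_add_const_Ico]
      congr 1 <;> rw [hc] <;> ring
    have hmp := (measurePreserving_add_right (volume : Measure ℝ) c).restrict_preimage
      (measurableSet_Ico (a := (1 / 2 : ℝ) ^ (k + 1)) (b := (1 / 2) ^ k))
    rw [hpre] at hmp
    rw [← hmp.map_eq]
    refine Measure.map_congr ((ae_restrict_iff' measurableSet_Ico).2 (Eventually.of_forall ?_))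
    intro x hx
    dsimp only
    rw [h k x (by linarith [hx.2]) (by linarith [hx.1]), hc]
    ring
  refine ⟨hT, ?_⟩
  conv_rhs => rw [← Measure.restrict_congr_set hran]
  have d1 : Pairwise (Function.onFun Disjoint
      fun k : ℕ => Ico (1 - (1 / 2 : ℝ) ^ k) (1 - (1 / 2) ^ (k + 1))) :=
    hmono.pairwise_disjoint_on_Ico_succ
  have d2 : Pairwise (Function.onFun Disjoint
      fun k : ℕ => Ico ((1 / 2 : ℝ) ^ (k + 1)) ((1 / 2) ^ k)) :=
    hanti.pairwise_disjoint_on_Ico_succ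
  rw [← hdom, Measure.restrict_iUnion d1 fun _ => measurableSet_Ico,
    Measure.map_sum hT.aemeasurable, Measure.restrict_iUnion d2 fun _ => measurableSet_Ico]
  exact congrArg Measure.sum (funext hpiece)

theorem ergodic (h : IsVonNeumannKakutani T) (hT : Measurable T) :
    Ergodic T (volume.restrict (Ico (0 : ℝ) 1)) := by
  refine ⟨h.measurePreserving hT, ⟨fun s hs hinv => ?_⟩⟩
  have hiter : ∀ (m : ℕ) (x : ℝ), T^[m] x ∈ s ↔ x ∈ s := by
    intro m x
    induction m with
    | zero => rfl
    | succ m ih => rw [Function.iterate_succ_apply', ← ih, ← mem_preimage, hinv]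
  set μ : Measure ℝ := volume.restrict (Ico (0 : ℝ) 1) with hμ
  have hν : μ.restrict s = μ.restrict s univ • μ := by
    refine measure_eq_smul_restrict_Ico_of_dyadic _ ?_ ?_ ?_
    · refine Measure.absolutelyContinuous_of_le Measure.restrict_le_self ?_
      rw [hμ, Measure.restrict_apply measurableSet_Iio]
      convert measure_empty (μ := (volume : Measure ℝ))
      ext x
      simp only [mem_inter_iff, mem_Iio, mem_Ico, mem_empty_iff_false, iff_false]
      intro hx
      linarith [hx.1, hx.2.1]
    · refine Measure.absolutelyContinuous_of_le Measure.restrict_le_self ?_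
      rw [hμ, Measure.restrict_apply measurableSet_Ici]
      convert measure_empty (μ := (volume : Measure ℝ))
      ext x
      simp only [mem_inter_iff, mem_Ici, mem_Ico, mem_empty_iff_false, iff_false]
      intro hx
      linarith [hx.1, hx.2.2]
    · have hsub : ∀ n j : ℕ, j < 2 ^ n →
          Ico (j * (1 / 2 : ℝ) ^ n) ((j + 1) * (1 / 2) ^ n) ⊆ Ico (0 : ℝ) 1 := by
        intro n j hj
        have h2 : (2 : ℝ) ^ n * (1 / 2) ^ n = 1 := by rw [← mul_pow]; norm_num
        have hj' : (j : ℝ) + 1 ≤ 2 ^ n := by exact_mod_cast hj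
        refine Ico_subset_Ico (by positivity) ?_
        exact (mul_le_mul_of_nonneg_right hj' (by positivity)).trans_eq h2
      have happ : ∀ n j : ℕ, j < 2 ^ n →
          μ.restrict s (Ico (j * (1 / 2 : ℝ) ^ n) ((j + 1) * (1 / 2) ^ n)) =
            volume (Ico (j * (1 / 2 : ℝ) ^ n) ((j + 1) * (1 / 2) ^ n) ∩ s) := by
        intro n j hj
        rw [Measure.restrict_apply measurableSet_Ico, hμ,
          Measure.restrict_eq_self _ (inter_subset_left.trans (hsub n j hj))]
      intro n j hj
      have e0 := happ n 0 (pow_pos two_pos n)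
      simp only [Nat.cast_zero, zero_mul, zero_add, one_mul] at e0
      rw [happ n j hj, e0,
        ← measure_preimage_add_right volume (j * (1 / 2 : ℝ) ^ n)
          (Ico (j * (1 / 2 : ℝ) ^ n) ((j + 1) * (1 / 2) ^ n) ∩ s)]
      congr 1
      obtain ⟨m, hm⟩ := h.exists_iterate_eq_add n j hj
      rw [preimage_inter, preimage_add_const_Ico]
      ext x
      rw [mem_inter_iff, mem_inter_iff, sub_self,
        show ((j : ℝ) + 1) * (1 / 2) ^ n - j * (1 / 2) ^ n = (1 / 2) ^ n by ring]
      refine and_congr_right fun hx => ?_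
      rw [mem_preimage, ← hm x hx, hiter]
  have hprob : μ univ = 1 := by simp [hμ]
  have hsq : μ s = μ s * μ s := by
    have := congrArg (fun ρ : Measure ℝ => ρ s) hν
    simpa using this
  have hfin : μ s ≠ ⊤ := measure_ne_top μ s
  rw [eventuallyConst_set']
  by_cases hz : μ s = 0
  · exact Or.inl (ae_eq_empty.2 hz)
  · refine Or.inr (ae_eq_univ.2 ?_)
    have hone : μ s = 1 := (ENNReal.mul_eq_left hz hfin).1 hsq.symm
    rw [measure_compl hs hfin, hprob, hone, tsub_self]

theorem iterate_odd_preimage_inter (h : IsVonNeumannKakutani T) (m : ℕ) :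
    T^[2 * m + 1] ⁻¹' Ico (0 : ℝ) (1 / 2) ∩ Ico (0 : ℝ) (1 / 2) = ∅ := by
  refine eq_empty_of_forall_notMem fun x hx => ?_
  have h1 := h.mapsTo_iterate_two_mul m hx.2
  have h2 : T^[2 * m + 1] x < 1 / 2 := hx.1.2
  rw [Function.iterate_succ_apply', h.apply_of_lt_half h1] at h2
  linarith [h1.1]

end IsVonNeumannKakutani

/-- Lebesgue measure on `[0,1]` is invariant and ergodic for the
von Neumann–Kakutani map `T`; moreover the system is topologically transitive (on `[0,1]`)
but not strongly mixing. -/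
theorem vonNeumann_Kakutani_ergodic_not_mixing (T : ℝ → ℝ) (hTmeas : Measurable T)
    (hT : ∀ k : ℕ, ∀ x ∈ Set.Ico (1 - (2:ℝ) ^ (-(k:ℤ))) (1 - (2:ℝ) ^ (-(k:ℤ) - 1)),
      T x = x - 1 + (2:ℝ) ^ (-(k:ℤ)) + (2:ℝ) ^ (-(k:ℤ) - 1))
    (hT1 : T 1 = 0) :
    MeasureTheory.MeasurePreserving T
        (MeasureTheory.volume.restrict (Set.Icc (0:ℝ) 1))
        (MeasureTheory.volume.restrict (Set.Icc (0:ℝ) 1)) ∧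
      Ergodic T (MeasureTheory.volume.restrict (Set.Icc (0:ℝ) 1)) ∧
      (∀ U V : Set ℝ, IsOpen U → IsOpen V →
        (U ∩ Set.Icc (0:ℝ) 1).Nonempty → (V ∩ Set.Icc (0:ℝ) 1).Nonempty →
        ∃ m : ℕ, (T^[m] '' (U ∩ Set.Icc (0:ℝ) 1) ∩ V).Nonempty) ∧
      ¬ (∀ B C : Set ℝ, MeasurableSet B → MeasurableSet C →
        Filter.Tendsto
          (fun m : ℕ =>
            MeasureTheory.volume.restrict (Set.Icc (0:ℝ) 1) (T^[m] ⁻¹' B ∩ C))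
          Filter.atTop
          (𝓝 (MeasureTheory.volume.restrict (Set.Icc (0:ℝ) 1) B *
            MeasureTheory.volume.restrict (Set.Icc (0:ℝ) 1) C))) := by
  have h : IsVonNeumannKakutani T := by
    intro k x h1 h2
    have e1 : (2 : ℝ) ^ (-(k : ℤ)) = (1 / 2) ^ k := by
      rw [zpow_neg, zpow_natCast, one_div, inv_pow]
    have e2 : (2 : ℝ) ^ (-(k : ℤ) - 1) = (1 / 2) ^ (k + 1) := by
      rw [zpow_sub_one₀ two_ne_zero, e1, pow_succ, one_div]
    have := hT k x
    rw [e1, e2] at this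
    exact this ⟨by linarith, by linarith⟩
  have hμ : (volume : Measure ℝ).restrict (Icc 0 1) = volume.restrict (Ico 0 1) :=
    (Measure.restrict_congr_set Ico_ae_eq_Icc).symm
  rw [hμ]
  refine ⟨h.measurePreserving hTmeas, h.ergodic hTmeas,
    fun U V hU hV hU' hV' => h.exists_iterate_mem hU hV hU' hV', fun hmix => ?_⟩
  have hlim := (hmix _ _ (measurableSet_Ico (a := (0 : ℝ)) (b := 1 / 2))
    (measurableSet_Ico (a := (0 : ℝ)) (b := 1 / 2))).comp
    (tendsto_atTop_mono (fun m : ℕ => (by omega : m ≤ 2 * m + 1)) tendsto_id)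
  have hzero := tendsto_nhds_unique hlim (tendsto_const_nhds.congr fun m => by
    rw [Function.comp_apply, h.iterate_odd_preimage_inter m, measure_empty])
  rw [mul_self_eq_zero, Measure.restrict_eq_self _ (Ico_subset_Ico_right (by norm_num)),
    Real.volume_Ico] at hzero
  norm_num at hzero
end
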